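/- arXiv:2406.13601 — 3 statements merged into one kernel-verified Lean document; each statement's English description precedes it below -/
import Mathlib

section
/- Let (A, φ) be a C*-probability space with faithful tracial φ and let X_1, …, X_n be free self-adjoint elements of A with φ(X_i) = 0 and φ(X_i²) = σ_i², B_n² := ∑_{i=1}^n σ_i² > 0. Set V_n² := B_n^{−2} ∑_{i=1}^n X_i² and assume L_{S,4n} < 1/16. Then (i) ‖V_n² − 1‖ < 4·L_{S,4n}^{1/2}, and (ii) V_n², its positive square root V_n, and V_n^{1/2} are all invertible in A. -/
open MeasureTheory Filter Topology

noncomputable section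

/-- Wigner's semicircle law: density `(2π)⁻¹ √(4 - t²)` on `[-2, 2]`. -/
def semicircleLaw : Measure ℝ :=
  volume.withDensity fun t =>
    ENNReal.ofReal (Set.indicator (Set.Icc (-2 : ℝ) 2)
      (fun t => (2 * Real.pi)⁻¹ * Real.sqrt (4 - t ^ 2)) t)

/-- Distribution function of a measure on `ℝ`. -/
def cdf (μ : Measure ℝ) (x : ℝ) : ℝ := (μ (Set.Iic x)).toReal

/-- Kolmogorov distance. -/
def kolDist (μ ν : Measure ℝ) : ℝ := ⨆ x : ℝ, |cdf μ x - cdf ν x|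

/-- Cauchy transform. -/
def cauchyG (μ : Measure ℝ) (z : ℂ) : ℂ := ∫ t, (z - (t : ℂ))⁻¹ ∂μ

/-- Support of a measure on `ℝ`. -/
def msupport (μ : Measure ℝ) : Set ℝ :=
  {x : ℝ | ∀ U : Set ℝ, IsOpen U → x ∈ U → 0 < μ U}

variable {A : Type*}

/-- `φ` is a state: unital and positive. -/
def IsState [Ring A] [StarRing A] [Algebra ℂ A] (φ : A →ₗ[ℂ] ℂ) : Prop :=
  φ 1 = 1 ∧ ∀ x : A, 0 ≤ (φ (star x * x)).re ∧ (φ (star x * x)).im = 0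

/-- `φ` is tracial. -/
def IsTracial [Ring A] [Algebra ℂ A] (φ : A →ₗ[ℂ] ℂ) : Prop :=
  ∀ x y : A, φ (x * y) = φ (y * x)

/-- `φ` is faithful. -/
def IsFaithful [Ring A] [StarRing A] [Algebra ℂ A] (φ : A →ₗ[ℂ] ℂ) : Prop :=
  ∀ x : A, φ (star x * x) = 0 → x = 0

/-- Freeness of a family of unital subalgebras w.r.t. `φ`. -/
def IsFreeFamily [Ring A] [Algebra ℂ A] (φ : A →ₗ[ℂ] ℂ)
    {I : Type*} (S : I → Subalgebra ℂ A) : Prop :=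
  ∀ (k : ℕ) (idx : Fin (k + 1) → I),
    (∀ j : Fin k, idx j.castSucc ≠ idx j.succ) →
    ∀ x : Fin (k + 1) → A, (∀ j, x j ∈ S (idx j)) → (∀ j, φ (x j) = 0) →
      φ (List.ofFn x).prod = 0

/-- Freeness of a family of elements: the generated unital subalgebras are free. -/
def AreFree [Ring A] [Algebra ℂ A] (φ : A →ₗ[ℂ] ℂ) {I : Type*} (X : I → A) : Prop :=
  IsFreeFamily φ fun i => Algebra.adjoin ℂ {X i}

/-- `μ` is the analytic distribution of `x`: a probability measure whose moments are the
`φ`-moments of `x`. -/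
def IsDistribution [Ring A] [Algebra ℂ A] (φ : A →ₗ[ℂ] ℂ) (x : A) (μ : Measure ℝ) : Prop :=
  IsProbabilityMeasure μ ∧ ∀ k : ℕ, φ (x ^ k) = ((∫ t, t ^ k ∂μ : ℝ) : ℂ)

/-- The Lyapunov-type fraction `L_{S,kn} = (∑_{i<n} ‖X i‖ ^ k) / B_n ^ k`. -/
def Lsn [Norm A] (X : ℕ → A) (σ : ℕ → ℝ) (k n : ℕ) : ℝ :=
  (∑ i ∈ Finset.range n, ‖X i‖ ^ k) /
    Real.sqrt (∑ i ∈ Finset.range n, σ i ^ 2) ^ k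

/-- `s` is a standard semicircular element. -/
def IsStdSemicircular [Ring A] [StarRing A] [Algebra ℂ A] (φ : A →ₗ[ℂ] ℂ) (s : A) : Prop :=
  IsSelfAdjoint s ∧ ∀ k : ℕ, φ (s ^ k) = ((∫ t, t ^ k ∂semicircleLaw : ℝ) : ℂ)

end

namespace FreeWords

section Algebraic

/-- The product of the letters of a word. -/
def wordProd {A I : Type*} [Monoid A] (l : List (I × A)) : A := (l.map Prod.snd).prod

/-- The index of the first letter of a word, if there is one. -/
def startIndex {A I : Type*} (l : List (I × A)) : Option I := l.head?.map Prod.fst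

@[simp] lemma wordProd_cons {A I : Type*} [Monoid A] (p : I × A) (l : List (I × A)) :
    wordProd (p :: l) = p.2 * wordProd l := by simp [wordProd]

@[simp] lemma startIndex_cons {A I : Type*} (p : I × A) (l : List (I × A)) :
    startIndex (p :: l) = some p.1 := rfl

variable {A I : Type*} [Ring A] [Algebra ℂ A]

/-- A list of letters `(i, a)` is reduced if neighbouring indices differ and every letter
is a centred element of its subalgebra. -/
def IsReduced (φ : A →ₗ[ℂ] ℂ) (S : I → Subalgebra ℂ A) (l : List (I × A)) : Prop :=
  l.IsChain (fun p q => p.1 ≠ q.1) ∧ ∀ p ∈ l, p.2 ∈ S p.1 ∧ φ p.2 = 0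

/-- The linear span of the reduced words whose first index satisfies `P`. -/
def wordSpan (φ : A →ₗ[ℂ] ℂ) (S : I → Subalgebra ℂ A) (P : Option I → Prop) : Submodule ℂ A :=
  Submodule.span ℂ {a | ∃ l, IsReduced φ S l ∧ P (startIndex l) ∧ wordProd l = a}

variable {φ : A →ₗ[ℂ] ℂ} {S : I → Subalgebra ℂ A}

lemma isReduced_cons {p : I × A} {l : List (I × A)} :
    IsReduced φ S (p :: l) ↔
      startIndex l ≠ some p.1 ∧ p.2 ∈ S p.1 ∧ φ p.2 = 0 ∧ IsReduced φ S l := by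
  cases l with
  | nil => simp [IsReduced, startIndex]
  | cons q l =>
    simp only [IsReduced, List.isChain_cons_cons, List.forall_mem_cons, startIndex_cons, ne_eq,
      Option.some.injEq, eq_comm (a := q.1)]
    tauto

lemma wordProd_mem {l : List (I × A)} {P : Option I → Prop} (hl : IsReduced φ S l)
    (hP : P (startIndex l)) : wordProd l ∈ wordSpan φ S P :=
  Submodule.subset_span ⟨l, hl, hP, rfl⟩

lemma one_mem_wordSpan {P : Option I → Prop} (hP : P none) : (1 : A) ∈ wordSpan φ S P :=
  wordProd_mem (l := []) (by simp [IsReduced]) hP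

lemma wordSpan_mono {P Q : Option I → Prop} (h : ∀ o, P o → Q o) :
    wordSpan φ S P ≤ wordSpan φ S Q :=
  Submodule.span_mono fun _ ⟨l, hl, hP, he⟩ => ⟨l, hl, h _ hP, he⟩

/-- A linear property of the span of words may be checked on the words. -/
lemma wordSpan_le {P : Option I → Prop} {V : Submodule ℂ A}
    (h : ∀ l, IsReduced φ S l → P (startIndex l) → wordProd l ∈ V) : wordSpan φ S P ≤ V :=
  Submodule.span_le.2 <| by rintro _ ⟨l, hl, hP, rfl⟩; exact h l hl hP

lemma map_wordProd_eq_zero (hfree : IsFreeFamily φ S) {l : List (I × A)}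
    (hl : IsReduced φ S l) (hne : l ≠ []) : φ (wordProd l) = 0 := by
  obtain ⟨n, f, rfl⟩ : ∃ (n : ℕ) (f : Fin n → I × A), l = List.ofFn f :=
    ⟨l.length, l.get, (List.ofFn_get l).symm⟩
  cases n with
  | zero => simp at hne
  | succ k =>
    obtain ⟨hc, hm⟩ := hl
    rw [List.isChain_ofFn] at hc
    rw [List.forall_mem_ofFn_iff] at hm
    rw [wordProd, List.map_ofFn]
    exact hfree k (fun j => (f j).1) (fun j => hc j (by omega)) (fun j => (f j).2)
      (fun j => (hm j).1) fun j => (hm j).2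

lemma centred_mul_mem_wordSpan {i : I} {x w : A} (hx : x ∈ S i) (hx0 : φ x = 0)
    (hw : w ∈ wordSpan φ S (· ≠ some i)) : x * w ∈ wordSpan φ S (· = some i) := by
  suffices h : wordSpan φ S (· ≠ some i) ≤
      (wordSpan φ S (· = some i)).comap (LinearMap.mulLeft ℂ x) from h hw
  refine wordSpan_le fun l hl hP => ?_
  have := wordProd_mem (φ := φ) (S := S) (P := (· = some i)) (l := (i, x) :: l)
    (isReduced_cons.2 ⟨hP, hx, hx0, hl⟩) rfl
  simpa using this

lemma mul_mem_wordSpan (h1 : φ 1 = 1) {i : I} {x w : A} (hx : x ∈ S i)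
    (hw : w ∈ wordSpan φ S fun _ => True) : x * w ∈ wordSpan φ S fun _ => True := by
  have key : ∀ y ∈ S i, ∀ l, IsReduced φ S l → startIndex l ≠ some i →
      y * wordProd l ∈ wordSpan φ S fun _ => True := by
    intro y hy l hl hP
    have hc : y - algebraMap ℂ A (φ y) ∈ S i := sub_mem hy (Subalgebra.algebraMap_mem _ _)
    have hc0 : φ (y - algebraMap ℂ A (φ y)) = 0 := by
      simp [Algebra.algebraMap_eq_smul_one, h1]
    have hm := wordSpan_mono (Q := fun _ => True) (fun _ _ => trivial)
      (centred_mul_mem_wordSpan hc hc0 (wordProd_mem hl hP))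
    have hs := (wordSpan φ S fun _ => True).smul_mem (φ y)
      (wordProd_mem (P := fun _ => True) hl trivial)
    have := add_mem hm hs
    rwa [sub_mul, ← Algebra.smul_def, sub_add_cancel] at this
  suffices h : wordSpan φ S (fun _ => True) ≤
      (wordSpan φ S fun _ => True).comap (LinearMap.mulLeft ℂ x) from h hw
  refine wordSpan_le fun l hl _ => ?_
  change x * wordProd l ∈ wordSpan φ S fun _ => True
  by_cases hP : startIndex l = some i
  · cases l with
    | nil => simp [startIndex] at hP
    | cons p l =>
      obtain ⟨h2, h3, -, h5⟩ := isReduced_cons.1 hl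
      have hp : p.1 = i := by simpa using hP
      rw [hp] at h2 h3
      rw [wordProd_cons, ← mul_assoc]
      exact key _ (mul_mem hx h3) l h5 h2
  · exact key x hx l hl hP

/-- Every element of the span of the reduced words splits, for each index `i`, into a part
starting in `i` and a part not starting in `i`. -/
lemma exists_components {w : A} (hw : w ∈ wordSpan φ S fun _ => True) :
    ∃ f : I → A, ∀ i, f i ∈ wordSpan φ S (· = some i) ∧
      w - f i ∈ wordSpan φ S (· ≠ some i) := by
  suffices h : ∀ i, ∃ a : A, a ∈ wordSpan φ S (· = some i) ∧ w - a ∈ wordSpan φ S (· ≠ some i) by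
    choose f hf using h
    exact ⟨f, hf⟩
  intro i
  suffices h : wordSpan φ S (fun _ => True) ≤
      wordSpan φ S (· = some i) ⊔ wordSpan φ S (· ≠ some i) by
    obtain ⟨a, ha, b, hb, rfl⟩ := Submodule.mem_sup.1 (h hw)
    exact ⟨a, ha, by simpa using hb⟩
  refine wordSpan_le fun l hl _ => ?_
  by_cases hP : startIndex l = some i
  · exact Submodule.mem_sup_left (wordProd_mem hl hP)
  · exact Submodule.mem_sup_right (wordProd_mem hl hP)

variable [StarRing A]

lemma map_star_mul_eq_zero (hfree : IsFreeFamily φ S) (hstar : ∀ x, φ (star x) = star (φ x))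
    (hS : ∀ i, ∀ x ∈ S i, star x ∈ S i) {P Q : Option I → Prop} (hPQ : ∀ o, P o → ¬ Q o)
    {u v : A} (hu : u ∈ wordSpan φ S P) (hv : v ∈ wordSpan φ S Q) : φ (star u * v) = 0 := by
  have hword : ∀ l, IsReduced φ S l → P (startIndex l) → ∀ m, IsReduced φ S m →
      Q (startIndex m) → φ (star (wordProd l) * wordProd m) = 0 := by
    intro l hl hP m hm hQ
    have hne : startIndex l ≠ startIndex m := fun h => hPQ _ hP (h ▸ hQ)
    set r : List (I × A) := (l.map fun p => (p.1, star p.2)).reverse with hr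
    have hstarprod : ∀ l : List (I × A),
        star (wordProd l) = wordProd (l.map fun p => (p.1, star p.2)).reverse := by
      intro l
      induction l with
      | nil => simp [wordProd]
      | cons p l ih => rw [wordProd_cons, star_mul, ih]; simp [wordProd]
    have hprod : star (wordProd l) * wordProd m = wordProd (r ++ m) := by
      rw [hstarprod]; simp [wordProd, hr]
    rw [hprod]
    refine map_wordProd_eq_zero hfree ⟨?_, ?_⟩ ?_
    · rw [List.isChain_append]
      refine ⟨?_, hm.1, ?_⟩
      · rw [hr, List.isChain_reverse, List.isChain_map]
        exact hl.1.imp fun _ _ h => Ne.symm h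
      · intro x hx y hy hxy
        apply hne
        rw [hr, List.getLast?_reverse, List.head?_map] at hx
        obtain ⟨p, hp, rfl⟩ := Option.map_eq_some_iff.1 hx
        simp only [startIndex, hp, Option.mem_def.1 hy, Option.map_some]
        exact congrArg some hxy
    · intro p hp
      rcases List.mem_append.1 hp with h | h
      · rw [hr, List.mem_reverse, List.mem_map] at h
        obtain ⟨q, hq, rfl⟩ := h
        exact ⟨hS _ _ (hl.2 q hq).1, by simp [hstar, (hl.2 q hq).2]⟩
      · exact hm.2 p h
    · intro h
      obtain ⟨h1, rfl⟩ := List.append_eq_nil_iff.1 h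
      have : l = [] := by simpa [hr] using h1
      exact hne (by rw [this])
  have hleft : ∀ l, IsReduced φ S l → P (startIndex l) → φ (star (wordProd l) * v) = 0 := by
    intro l hl hP
    suffices h : wordSpan φ S Q ≤
        LinearMap.ker (φ ∘ₗ LinearMap.mulLeft ℂ (star (wordProd l))) from h hv
    exact wordSpan_le fun m hm hQ => hword l hl hP m hm hQ
  have hflip : ∀ l, IsReduced φ S l → P (startIndex l) → φ (star v * wordProd l) = 0 := by
    intro l hl hP
    have := hstar (star (wordProd l) * v)
    rw [hleft l hl hP, star_mul, star_star, star_zero] at this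
    exact this
  have hfin : φ (star v * u) = 0 := by
    suffices h : wordSpan φ S P ≤ LinearMap.ker (φ ∘ₗ LinearMap.mulLeft ℂ (star v)) from h hu
    exact wordSpan_le fun l hl hP => hflip l hl hP
  have := hstar (star v * u)
  rw [hfin, star_mul, star_star, star_zero] at this
  exact this

end Algebraic

section InnerProduct

variable {E I : Type*} [SeminormedAddCommGroup E] [InnerProductSpace ℂ E]

open scoped InnerProductSpace

/-- Bessel's inequality for pairwise orthogonal components of a vector. -/
lemma sum_norm_sq_components_le (s : Finset I) {x : I → E} {ξ : E}
    (hx : ∀ i ∈ s, ⟪x i, ξ - x i⟫_ℂ = 0)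
    (hpair : ∀ i ∈ s, ∀ j ∈ s, i ≠ j → ⟪x i, x j⟫_ℂ = 0) :
    ∑ i ∈ s, ‖x i‖ ^ 2 ≤ ‖ξ‖ ^ 2 := by
  have hself : ∀ i ∈ s, ⟪x i, ξ⟫_ℂ = ((‖x i‖ ^ 2 : ℝ) : ℂ) := by
    intro i hi
    have h := hx i hi
    rw [inner_sub_right, sub_eq_zero, inner_self_eq_norm_sq_to_K] at h
    rw [h]; norm_cast
  have h1 : ⟪∑ i ∈ s, x i, ξ⟫_ℂ = ((∑ i ∈ s, ‖x i‖ ^ 2 : ℝ) : ℂ) := by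
    rw [sum_inner, Finset.sum_congr rfl hself]; push_cast; rfl
  have h2 : ⟪∑ i ∈ s, x i, ∑ i ∈ s, x i⟫_ℂ = ((∑ i ∈ s, ‖x i‖ ^ 2 : ℝ) : ℂ) := by
    rw [sum_inner]
    push_cast
    refine Finset.sum_congr rfl fun i hi => ?_
    rw [inner_sum, Finset.sum_eq_single_of_mem i hi fun j hj hji => hpair i hi j hj hji.symm,
      inner_self_eq_norm_sq_to_K]
    rfl
  have h3 : ∑ i ∈ s, ‖x i‖ ^ 2 = ‖∑ i ∈ s, x i‖ ^ 2 := by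
    rw [inner_self_eq_norm_sq_to_K] at h2
    exact Complex.ofReal_injective (by rw [← h2]; norm_cast)
  have h4 : ∑ i ∈ s, ‖x i‖ ^ 2 ≤ ‖∑ i ∈ s, x i‖ * ‖ξ‖ := by
    have := norm_inner_le_norm (𝕜 := ℂ) (∑ i ∈ s, x i) ξ
    rw [h1, Complex.norm_real, Real.norm_of_nonneg (by positivity)] at this
    exact this
  rw [h3] at h4 ⊢
  have := norm_nonneg (∑ i ∈ s, x i)
  have := norm_nonneg ξ
  nlinarith [sq_nonneg (‖∑ i ∈ s, x i‖ - ‖ξ‖)]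

/-- If each symmetric `T i` has no corner on the complementary components of `ζ` and `ξ`, then
the form of `∑ i ∈ s, T i` is controlled by the square sum of the bounds of the `T i`. -/
lemma norm_sum_inner_le (s : Finset I) {T : I → E →ₗ[ℂ] E}
    (hT : ∀ i ∈ s, ∀ u v, ⟪T i u, v⟫_ℂ = ⟪u, T i v⟫_ℂ) {c : I → ℝ} (hc : ∀ i ∈ s, 0 ≤ c i)
    (hTc : ∀ i ∈ s, ∀ u, ‖T i u‖ ≤ c i * ‖u‖) {ζ ξ : E} {z x : I → E}
    (hz : ∑ i ∈ s, ‖z i‖ ^ 2 ≤ ‖ζ‖ ^ 2) (hx : ∑ i ∈ s, ‖x i‖ ^ 2 ≤ ‖ξ‖ ^ 2)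
    (hz' : ∀ i ∈ s, ‖ζ - z i‖ ≤ ‖ζ‖) (hx' : ∀ i ∈ s, ‖ξ - x i‖ ≤ ‖ξ‖)
    (hcorner : ∀ i ∈ s, ⟪ζ - z i, T i (ξ - x i)⟫_ℂ = 0) :
    ‖∑ i ∈ s, ⟪ζ, T i ξ⟫_ℂ‖ ≤ 3 * √(∑ i ∈ s, c i ^ 2) * ‖ζ‖ * ‖ξ‖ := by
  set D := √(∑ i ∈ s, c i ^ 2) with hD
  have hcD : ∀ i ∈ s, c i ≤ D := fun i hi =>
    Real.le_sqrt_of_sq_le (Finset.single_le_sum (f := fun i => c i ^ 2)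
      (fun j _ => sq_nonneg _) hi)
  have hterm : ∀ i ∈ s, ‖⟪ζ, T i ξ⟫_ℂ‖ ≤
      D * (‖z i‖ * ‖x i‖) + (‖z i‖ * c i) * ‖ξ‖ + (c i * ‖x i‖) * ‖ζ‖ := by
    intro i hi
    have hsplit : ⟪ζ, T i ξ⟫_ℂ =
        ⟪z i, T i (x i)⟫_ℂ + ⟪z i, T i (ξ - x i)⟫_ℂ + ⟪T i (ζ - z i), x i⟫_ℂ := by
      have h0 := hcorner i hi
      rw [hT i hi]
      simp only [map_sub, inner_sub_left, inner_sub_right] at h0 ⊢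
      linear_combination h0
    rw [hsplit]
    refine (norm_add₃_le).trans (add_le_add_three ?_ ?_ ?_)
    · calc ‖⟪z i, T i (x i)⟫_ℂ‖ ≤ ‖z i‖ * (D * ‖x i‖) :=
            (norm_inner_le_norm _ _).trans <| by
              gcongr
              exact (hTc i hi _).trans (by gcongr; exact hcD i hi)
        _ = _ := by ring
    · calc ‖⟪z i, T i (ξ - x i)⟫_ℂ‖ ≤ ‖z i‖ * (c i * ‖ξ‖) :=
            (norm_inner_le_norm _ _).trans <| by
              gcongr
              exact (hTc i hi _).trans (mul_le_mul_of_nonneg_left (hx' i hi) (hc i hi))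
        _ = _ := by ring
    · calc ‖⟪T i (ζ - z i), x i⟫_ℂ‖ ≤ (c i * ‖ζ‖) * ‖x i‖ :=
            (norm_inner_le_norm _ _).trans <| by
              gcongr
              exact (hTc i hi _).trans (mul_le_mul_of_nonneg_left (hz' i hi) (hc i hi))
        _ = _ := by ring
  have hzs : √(∑ i ∈ s, ‖z i‖ ^ 2) ≤ ‖ζ‖ := Real.sqrt_le_left (norm_nonneg _) |>.2 hz
  have hxs : √(∑ i ∈ s, ‖x i‖ ^ 2) ≤ ‖ξ‖ := Real.sqrt_le_left (norm_nonneg _) |>.2 hx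
  have h1 : ∑ i ∈ s, ‖z i‖ * ‖x i‖ ≤ ‖ζ‖ * ‖ξ‖ :=
    (Real.sum_mul_le_sqrt_mul_sqrt _ _ _).trans (by gcongr)
  have h2 : ∑ i ∈ s, ‖z i‖ * c i ≤ ‖ζ‖ * D :=
    (Real.sum_mul_le_sqrt_mul_sqrt _ _ _).trans (by gcongr)
  have h3 : ∑ i ∈ s, c i * ‖x i‖ ≤ D * ‖ξ‖ :=
    (Real.sum_mul_le_sqrt_mul_sqrt _ _ _).trans (by gcongr)
  calc ‖∑ i ∈ s, ⟪ζ, T i ξ⟫_ℂ‖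
      ≤ ∑ i ∈ s, (D * (‖z i‖ * ‖x i‖) + (‖z i‖ * c i) * ‖ξ‖ + (c i * ‖x i‖) * ‖ζ‖) :=
        norm_sum_le_of_le _ hterm
    _ = D * (∑ i ∈ s, ‖z i‖ * ‖x i‖) + (∑ i ∈ s, ‖z i‖ * c i) * ‖ξ‖
          + (∑ i ∈ s, c i * ‖x i‖) * ‖ζ‖ := by
        rw [Finset.sum_add_distrib, Finset.sum_add_distrib, Finset.mul_sum, Finset.sum_mul,
          Finset.sum_mul]
    _ ≤ D * (‖ζ‖ * ‖ξ‖) + (‖ζ‖ * D) * ‖ξ‖ + (D * ‖ξ‖) * ‖ζ‖ := by gcongr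
    _ = 3 * D * ‖ζ‖ * ‖ξ‖ := by ring

end InnerProduct

section CStar

open scoped ComplexOrder InnerProductSpace

variable {A I : Type*} [CStarAlgebra A] [PartialOrder A] [StarOrderedRing A]
  (f : A →ₚ[ℂ] ℂ)

/-- A faithful positive functional computes the norm of a self-adjoint element from its even
moments. -/
lemma norm_le_of_even_moments (hfaith : ∀ x : A, f (star x * x) = 0 → x = 0) {b : A}
    (hb : IsSelfAdjoint b) {K : ℝ} (hK : 0 ≤ K)
    (hmom : ∀ k : ℕ, (f (b ^ (2 * k))).re ≤ K ^ (2 * k)) :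
    ‖b‖ ≤ K := by
  by_contra! hlt
  have hnt : Nontrivial A := ⟨b, 0, by rintro rfl; simp at hlt; linarith⟩
  obtain ⟨R, hKR, hRb⟩ := exists_between hlt
  have hR : 0 < R := hK.trans_lt hKR
  set g : ℝ → ℝ := fun t => max (|t| - R) 0 with hg
  have hgc : Continuous g := by fun_prop
  have hpt : ∀ k : ℕ, ∀ t ∈ spectrum ℝ b, g t * g t ≤ ‖b‖ ^ 2 / R ^ (2 * k) * t ^ (2 * k) := by
    intro k t ht
    have htb : |t| ≤ ‖b‖ := by simpa using spectrum.norm_le_norm_of_mem ht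
    rcases le_total |t| R with h | h
    · have : g t = 0 := by simp [hg, h]
      rw [this, zero_mul, pow_mul t]; positivity
    · have hgt : g t = |t| - R := by simp [hg, h]
      have h1 : g t * g t ≤ ‖b‖ ^ 2 := by rw [hgt]; nlinarith
      have h2 : R ^ (2 * k) ≤ t ^ (2 * k) := by
        rw [← (even_two_mul k).pow_abs t]; gcongr
      rw [div_mul_eq_mul_div, le_div_iff₀ (by positivity)]
      gcongr
  have hbound : ∀ k : ℕ, (f (cfc g b * cfc g b)).re ≤ ‖b‖ ^ 2 * ((K / R) ^ 2) ^ k := by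
    intro k
    have hle : cfc g b * cfc g b ≤ (‖b‖ ^ 2 / R ^ (2 * k)) • b ^ (2 * k) := by
      rw [← cfc_mul g g b, ← cfc_pow_id (R := ℝ) b (2 * k), ← cfc_smul _ _ _]
      exact cfc_mono (hpt k)
    have h := (Complex.le_def.1 (OrderHomClass.mono f hle)).1
    rw [← Complex.coe_smul, map_smul, smul_eq_mul, Complex.re_ofReal_mul] at h
    calc _ ≤ _ := h
      _ ≤ ‖b‖ ^ 2 / R ^ (2 * k) * K ^ (2 * k) := by gcongr; exact hmom k
      _ = _ := by rw [← pow_mul, div_pow]; ring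
  have hlim : Tendsto (fun k : ℕ => ‖b‖ ^ 2 * ((K / R) ^ 2) ^ k) atTop (𝓝 (‖b‖ ^ 2 * 0)) :=
    (tendsto_pow_atTop_nhds_zero_of_lt_one (by positivity)
      (pow_lt_one₀ (by positivity) ((div_lt_one hR).2 hKR) two_ne_zero)).const_mul _
  rw [mul_zero] at hlim
  have hle0 : (f (cfc g b * cfc g b)).re ≤ 0 := ge_of_tendsto' hlim hbound
  have hgs : star (cfc g b) = cfc g b := (cfc_predicate g b : IsSelfAdjoint _)
  have hpos : 0 ≤ f (cfc g b * cfc g b) := by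
    nth_rewrite 1 [← hgs]
    exact f.map_nonneg (star_mul_self_nonneg _)
  have hzero : f (star (cfc g b) * cfc g b) = 0 := by
    rw [hgs]
    exact le_antisymm (Complex.le_def.2 ⟨hle0, (Complex.le_def.1 hpos).2.symm⟩) hpos
  have hcfc := hfaith _ hzero
  have hval : ∀ t ∈ spectrum ℝ b, g t = 0 := by
    intro t ht
    have := norm_apply_le_norm_cfc g b ht
    rw [hcfc, norm_zero] at this
    exact norm_le_zero_iff.1 this
  have : max (‖b‖ - R) 0 = 0 := by
    rcases CStarAlgebra.norm_or_neg_norm_mem_spectrum hb with h | h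
    · simpa [hg] using hval _ h
    · simpa [hg] using hval _ h
  have := max_eq_right_iff.1 this
  linarith

/-- A sum of free centred self-adjoint elements is bounded in norm by three times the square
root of the sum of their squared norms. -/
theorem norm_sum_le_of_free (hf1 : f 1 = 1) (hfaith : ∀ x : A, f (star x * x) = 0 → x = 0)
    {S : I → Subalgebra ℂ A} (hfree : IsFreeFamily f.toLinearMap S)
    (hS : ∀ i, ∀ x ∈ S i, star x ∈ S i) (s : Finset I) {Y : I → A}
    (hY : ∀ i ∈ s, Y i ∈ S i) (hsa : ∀ i ∈ s, IsSelfAdjoint (Y i)) (hY0 : ∀ i ∈ s, f (Y i) = 0) :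
    ‖∑ i ∈ s, Y i‖ ≤ 3 * √(∑ i ∈ s, ‖Y i‖ ^ 2) := by
  set a := ∑ i ∈ s, Y i with ha
  set K := 3 * √(∑ i ∈ s, ‖Y i‖ ^ 2) with hK
  have hasa : IsSelfAdjoint a := isSelfAdjoint_sum _ hsa
  have hstar : ∀ x, f.toLinearMap (star x) = star (f.toLinearMap x) := fun x => map_star f x
  set W := wordSpan f.toLinearMap S fun _ => True with hW
  have horth : ∀ {P Q : Option I → Prop}, (∀ o, P o → ¬ Q o) →
      ∀ {u v : A}, u ∈ wordSpan f.toLinearMap S P → v ∈ wordSpan f.toLinearMap S Q →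
      ⟪f.toPreGNS u, f.toPreGNS v⟫_ℂ = 0 := fun hPQ _ _ hu hv =>
    map_star_mul_eq_zero hfree hstar hS hPQ hu hv
  have haW : ∀ w ∈ W, a * w ∈ W := by
    intro w hw
    rw [ha, Finset.sum_mul]
    exact sum_mem fun i hi => mul_mem_wordSpan hf1 (hY i hi) hw
  have hcomp : ∀ w ∈ W, ∃ x : I → A, (∀ i, x i ∈ wordSpan f.toLinearMap S (· = some i) ∧
      w - x i ∈ wordSpan f.toLinearMap S (· ≠ some i)) ∧
      ∑ i ∈ s, ‖f.toPreGNS (x i)‖ ^ 2 ≤ ‖f.toPreGNS w‖ ^ 2 ∧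
      ∀ i ∈ s, ‖f.toPreGNS w - f.toPreGNS (x i)‖ ≤ ‖f.toPreGNS w‖ := by
    intro w hw
    obtain ⟨x, hx⟩ := exists_components hw
    have hxo : ∀ i, ⟪f.toPreGNS (x i), f.toPreGNS w - f.toPreGNS (x i)⟫_ℂ = 0 := by
      intro i
      rw [← map_sub]
      exact horth (fun o h1 h2 => h2 h1) (hx i).1 (hx i).2
    refine ⟨x, hx, sum_norm_sq_components_le s (fun i _ => hxo i) ?_, ?_⟩
    · intro i _ j _ hij
      refine horth (fun o h1 h2 => hij ?_) (hx i).1 (hx j).1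
      exact Option.some_injective _ (h1.symm.trans h2)
    · intro i _
      have h := norm_add_sq_eq_norm_sq_add_norm_sq_of_inner_eq_zero _ _ (hxo i)
      rw [add_sub_cancel] at h
      nlinarith [norm_nonneg (f.toPreGNS w), norm_nonneg (f.toPreGNS (x i)),
        norm_nonneg (f.toPreGNS w - f.toPreGNS (x i))]
  have hbil : ∀ w ∈ W, ∀ v ∈ W, ‖⟪f.toPreGNS v, f.toPreGNS (a * w)⟫_ℂ‖ ≤
      K * ‖f.toPreGNS v‖ * ‖f.toPreGNS w‖ := by
    intro w hw v hv
    obtain ⟨x, hx, hx1, hx2⟩ := hcomp w hw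
    obtain ⟨z, hz, hz1, hz2⟩ := hcomp v hv
    have key := norm_sum_inner_le s (T := fun i => (f.leftMulMapPreGNS (Y i)).toLinearMap)
      (c := fun i => ‖Y i‖) ?_ (fun _ _ => norm_nonneg _) ?_ hz1 hx1 hz2 hx2 ?_
    · convert key using 2
      rw [← inner_sum, ha, Finset.sum_mul, map_sum]
      rfl
    · intro i hi p q
      change f (star (Y i * f.ofPreGNS p) * f.ofPreGNS q) =
        f (star (f.ofPreGNS p) * (Y i * f.ofPreGNS q))
      rw [star_mul, (hsa i hi).star_eq, mul_assoc]
    · intro i hi p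
      exact (f.leftMulMapPreGNS (Y i)).le_of_opNorm_le
        (LinearMap.mkContinuous_norm_le _ (norm_nonneg _) _) p
    · intro i hi
      rw [← map_sub, ← map_sub]
      exact horth (P := (· ≠ some i)) (Q := (· = some i)) (fun o h1 h2 => h1 h2) (hz i).2
        (centred_mul_mem_wordSpan (hY i hi) (hY0 i hi) (hx i).2)
  have hop : ∀ w ∈ W, ‖f.toPreGNS (a * w)‖ ≤ K * ‖f.toPreGNS w‖ := by
    intro w hw
    have h := hbil w hw _ (haW w hw)
    rw [inner_self_eq_norm_sq_to_K, norm_pow, RCLike.norm_ofReal, abs_norm] at h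
    rcases (norm_nonneg (f.toPreGNS (a * w))).eq_or_lt with h0 | h0
    · rw [← h0]; positivity
    · exact le_of_mul_le_mul_left (by linarith) h0
  have hone : ‖f.toPreGNS (1 : A)‖ = 1 := by
    simp [PositiveLinearMap.preGNS_norm_def, hf1]
  have hpow : ∀ k : ℕ, a ^ k ∈ W ∧ ‖f.toPreGNS (a ^ k)‖ ≤ K ^ k := by
    intro k
    induction k with
    | zero => simpa [hone] using one_mem_wordSpan (P := fun _ => True) trivial
    | succ k ih =>
      rw [pow_succ']
      refine ⟨haW _ ih.1, (hop _ ih.1).trans ?_⟩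
      rw [pow_succ']
      gcongr
      exact ih.2
  refine norm_le_of_even_moments f hfaith hasa (by positivity) fun k => ?_
  have h := f.preGNS_norm_sq (f.toPreGNS (a ^ k))
  rw [f.ofPreGNS_toPreGNS, star_pow, hasa.star_eq, ← pow_add, ← two_mul] at h
  rw [← h, ← Complex.ofReal_pow, Complex.ofReal_re, mul_comm, pow_mul]
  gcongr
  exact (hpow k).2

end CStar

end FreeWords

section State

open scoped ComplexOrder

variable {A : Type*} [CStarAlgebra A] [PartialOrder A] [StarOrderedRing A]

/-- A state, as a bundled positive linear map. -/
noncomputable def IsState.toPositiveLinearMap {φ : A →ₗ[ℂ] ℂ} (hφ : IsState φ) : A →ₚ[ℂ] ℂ :=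
  PositiveLinearMap.mk₀ φ fun x hx => by
    obtain ⟨y, rfl⟩ := CStarAlgebra.nonneg_iff_eq_star_mul_self.1 hx
    exact Complex.le_def.2 ⟨(hφ.2 y).1, (hφ.2 y).2.symm⟩

lemma IsState.re_le_norm {φ : A →ₗ[ℂ] ℂ} (hφ : IsState φ) {x : A} (hx : IsSelfAdjoint x) :
    (φ x).re ≤ ‖x‖ := by
  have h := (Complex.le_def.1 (OrderHomClass.mono hφ.toPositiveLinearMap
    hx.le_algebraMap_norm_self)).1
  change (φ x).re ≤ (φ (algebraMap ℝ A ‖x‖)).re at h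
  rwa [Algebra.algebraMap_eq_smul_one, ← Complex.coe_smul, map_smul, hφ.1, smul_eq_mul, mul_one,
    Complex.ofReal_re] at h

/-- Subtracting from a nonnegative element a scalar below a bound of its norm keeps that bound. -/
lemma norm_sub_algebraMap_le {x : A} (hx : 0 ≤ x) {t r : ℝ} (ht : 0 ≤ t) (htr : t ≤ r)
    (hxr : ‖x‖ ≤ r) : ‖x - algebraMap ℝ A t‖ ≤ r := by
  rcases subsingleton_or_nontrivial A with h | h
  · simpa [Subsingleton.elim (x - algebraMap ℝ A t) 0] using ht.trans htr
  have hmem : ∀ l ∈ spectrum ℝ (x - algebraMap ℝ A t), l + t ∈ spectrum ℝ x := by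
    intro l hl
    rwa [spectrum.add_mem_iff, neg_add_eq_sub]
  have hsa : IsSelfAdjoint (x - algebraMap ℝ A t) :=
    (IsSelfAdjoint.of_nonneg hx).sub (IsSelfAdjoint.algebraMap A (IsSelfAdjoint.all t))
  rcases CStarAlgebra.norm_or_neg_norm_mem_spectrum hsa with h | h
  · have := (le_abs_self _).trans (spectrum.norm_le_norm_of_mem (hmem _ h))
    linarith
  · have := spectrum_nonneg_of_nonneg hx (hmem _ h)
    linarith

/-- The deviation of `∑ X i ^ 2` from its mean, for free self-adjoint `X i`. -/
theorem norm_sum_sq_sub_le {φ : A →ₗ[ℂ] ℂ} (hφ : IsState φ) (hFa : IsFaithful φ) {I : Type*}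
    {X : I → A} {σ : I → ℝ} (hsa : ∀ i, IsSelfAdjoint (X i)) (hfree : AreFree φ X)
    (hvar : ∀ i, φ (X i ^ 2) = ((σ i ^ 2 : ℝ) : ℂ)) (s : Finset I) :
    ‖∑ i ∈ s, (X i ^ 2 - algebraMap ℝ A (σ i ^ 2))‖ ≤ 3 * √(∑ i ∈ s, ‖X i‖ ^ 4) := by
  have hS : ∀ i, ∀ x ∈ Algebra.adjoin ℂ {X i}, star x ∈ Algebra.adjoin ℂ {X i} := by
    intro i x hx
    have h : star x ∈ star (Algebra.adjoin ℂ {X i}) := Subalgebra.star_mem_star_iff _ _ |>.2 hx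
    rwa [Subalgebra.star_adjoin_comm, Set.star_singleton, (hsa i).star_eq] at h
  have hnorm : ∀ i, ‖X i ^ 2‖ ≤ ‖X i‖ ^ 2 := fun i => norm_pow_le' _ two_pos
  have hdev : ∀ i, ‖X i ^ 2 - algebraMap ℝ A (σ i ^ 2)‖ ≤ ‖X i‖ ^ 2 := by
    intro i
    refine norm_sub_algebraMap_le (hsa i).sq_nonneg (sq_nonneg _) ?_ (hnorm i)
    have h := hφ.re_le_norm ((hsa i).pow 2)
    rw [hvar, Complex.ofReal_re] at h
    exact h.trans (hnorm i)
  refine (FreeWords.norm_sum_le_of_free hφ.toPositiveLinearMap hφ.1 hFa (S := fun i =>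
    Algebra.adjoin ℂ {X i}) hfree hS s (fun i _ => ?_) (fun i _ => ?_) fun i _ => ?_).trans ?_
  · refine sub_mem (pow_mem (Algebra.self_mem_adjoin_singleton ℂ _) 2) ?_
    rw [IsScalarTower.algebraMap_apply ℝ ℂ A]
    exact Subalgebra.algebraMap_mem _ _
  · exact ((hsa i).pow 2).sub (IsSelfAdjoint.algebraMap A (IsSelfAdjoint.all _))
  · change φ _ = 0
    rw [map_sub, hvar, IsScalarTower.algebraMap_apply ℝ ℂ A, Algebra.algebraMap_eq_smul_one,
      map_smul, hφ.1]
    simp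
  · gcongr with i _
    calc ‖X i ^ 2 - algebraMap ℝ A (σ i ^ 2)‖ ^ 2 ≤ (‖X i‖ ^ 2) ^ 2 := by gcongr; exact hdev i
      _ = ‖X i‖ ^ 4 := by ring

end State

/-- **Lemma 4.3**: if `L_{S,4n} < 1/16` then (i) `‖V_n² - 1‖ < 4·L_{S,4n}^{1/2}` for the
normalized sum `V_n² = B_n^{-2} ∑ X_i²`, and (ii) `V_n²`, its positive square root `V_n`,
and the positive square root `V_n^{1/2}` of `V_n` are all invertible in `A`. -/
theorem stmt_6 (A : Type*) [NormedRing A] [StarRing A] [CStarRing A] [NormedAlgebra ℂ A]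
    [CompleteSpace A] [StarModule ℂ A] [PartialOrder A] [StarOrderedRing A]
    (φ : A →ₗ[ℂ] ℂ) (hφ : IsState φ) (hTr : IsTracial φ) (hFa : IsFaithful φ)
    (X : ℕ → A) (σ : ℕ → ℝ) (n : ℕ)
    (hsa : ∀ i, IsSelfAdjoint (X i)) (hfree : AreFree φ X)
    (hmean : ∀ i, φ (X i) = 0) (hvar : ∀ i, φ (X i ^ 2) = ((σ i ^ 2 : ℝ) : ℂ))
    (hB : 0 < ∑ i ∈ Finset.range n, σ i ^ 2)
    (hL4 : Lsn X σ 4 n < 1 / 16) :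
    ‖(((∑ i ∈ Finset.range n, σ i ^ 2 : ℝ) : ℂ))⁻¹ • (∑ i ∈ Finset.range n, X i ^ 2)
        - (1 : A)‖ < 4 * Real.sqrt (Lsn X σ 4 n) ∧
    IsUnit ((((∑ i ∈ Finset.range n, σ i ^ 2 : ℝ) : ℂ))⁻¹ • (∑ i ∈ Finset.range n, X i ^ 2)) ∧
    (∃ V : A, 0 ≤ V ∧
      V ^ 2 = (((∑ i ∈ Finset.range n, σ i ^ 2 : ℝ) : ℂ))⁻¹ • (∑ i ∈ Finset.range n, X i ^ 2) ∧
      IsUnit V ∧ ∃ Vr : A, 0 ≤ Vr ∧ Vr ^ 2 = V ∧ IsUnit Vr) ∧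
    ∀ V : A, 0 ≤ V →
      V ^ 2 = (((∑ i ∈ Finset.range n, σ i ^ 2 : ℝ) : ℂ))⁻¹ • (∑ i ∈ Finset.range n, X i ^ 2) →
      IsUnit V ∧ ∀ Vr : A, 0 ≤ Vr → Vr ^ 2 = V → IsUnit Vr := by
  let _ : CStarAlgebra A := { (inferInstance : NormedRing A), (inferInstance : StarRing A),
    (inferInstance : CompleteSpace A), (inferInstance : CStarRing A),
    (inferInstance : NormedAlgebra ℂ A), (inferInstance : StarModule ℂ A) with }
  set B := ∑ i ∈ Finset.range n, σ i ^ 2 with hBdef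
  set Q := ((B : ℝ) : ℂ)⁻¹ • ∑ i ∈ Finset.range n, X i ^ 2 with hQ
  have hL : Lsn X σ 4 n = (∑ i ∈ Finset.range n, ‖X i‖ ^ 4) / B ^ 2 := by
    rw [Lsn, ← hBdef]
    congr 1
    rw [show 4 = 2 * 2 from rfl, pow_mul, Real.sq_sqrt hB.le]
  have hLpos : 0 < Lsn X σ 4 n := by
    rw [hL]
    refine div_pos ?_ (by positivity)
    obtain ⟨i, hi, hne⟩ := Finset.exists_ne_zero_of_sum_ne_zero hB.ne'
    refine Finset.sum_pos' (fun _ _ => by positivity) ⟨i, hi, ?_⟩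
    have hX : X i ≠ 0 := by
      intro h
      have := hvar i
      rw [h, zero_pow two_ne_zero, map_zero] at this
      exact hne (by exact_mod_cast this.symm)
    positivity
  have hBC : (B : ℂ) ≠ 0 := by exact_mod_cast hB.ne'
  have hdiff : Q - 1 =
      (B : ℂ)⁻¹ • ∑ i ∈ Finset.range n, (X i ^ 2 - algebraMap ℝ A (σ i ^ 2)) := by
    rw [Finset.sum_sub_distrib, ← map_sum, ← hBdef, smul_sub, ← hQ,
      IsScalarTower.algebraMap_apply ℝ ℂ A, Algebra.algebraMap_eq_smul_one, smul_smul,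
      Complex.coe_algebraMap, inv_mul_cancel₀ hBC, one_smul]
  have hnorm : ‖Q - 1‖ < 4 * √(Lsn X σ 4 n) := by
    have h3 : ‖Q - 1‖ ≤ 3 * √(Lsn X σ 4 n) := by
      rw [hdiff, norm_smul, norm_inv, Complex.norm_real, Real.norm_of_nonneg hB.le, hL,
        Real.sqrt_div' _ (sq_nonneg B), Real.sqrt_sq hB.le, mul_div_assoc', div_eq_inv_mul]
      gcongr
      exact norm_sum_sq_sub_le hφ hFa hsa hfree hvar _
    have := Real.sqrt_pos.2 hLpos
    linarith
  have hsqrt : √(Lsn X σ 4 n) < 1 / 4 :=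
    (Real.sqrt_lt' (by norm_num)).2 (by norm_num; linarith)
  have hunit : IsUnit Q := by
    have h := isUnit_one_sub_of_norm_lt_one (x := 1 - Q) (by rw [norm_sub_rev]; linarith)
    rwa [sub_sub_cancel] at h
  have hQ0 : 0 ≤ Q := by
    rw [hQ, ← Complex.ofReal_inv, Complex.coe_smul]
    exact smul_nonneg (inv_nonneg.2 hB.le) (Finset.sum_nonneg fun i _ => (hsa i).sq_nonneg)
  have hroot : ∀ {V P : A}, IsUnit P → V ^ 2 = P → IsUnit V := fun hP h =>
    (isUnit_pow_iff two_ne_zero).1 (h ▸ hP)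
  have hex : ∀ P : A, 0 ≤ P → CFC.sqrt P ^ 2 = P := fun P hP => CFC.sq_sqrt P hP
  refine ⟨hnorm, hunit, ?_, ?_⟩
  · have hV := hroot hunit (hex Q hQ0)
    exact ⟨CFC.sqrt Q, CFC.sqrt_nonneg Q, hex Q hQ0, hV, CFC.sqrt (CFC.sqrt Q),
      CFC.sqrt_nonneg _, hex _ (CFC.sqrt_nonneg Q), hroot hV (hex _ (CFC.sqrt_nonneg Q))⟩
  · intro V _ hV
    exact ⟨hroot hunit hV, fun Vr _ hVr => hroot (hroot hunit hV) hVr⟩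
end

section
/- Let μ and ν be probability measures on ℝ with distribution functions F_μ, F_ν and Cauchy transforms G_μ, G_ν, with ∫_{−∞}^{∞} |F_μ(x) − F_ν(x)| dx < ∞. Choose v ∈ (0,1), ε ∈ (0,2), a, γ > 0 with γ = (1/π)∫_{|x|<a} 1/(1+x²) dx > 1/2 and ε > 2va, and set Δ_ε(μ,ν) := sup_{x ∈ [−2+ε, 2−ε]} |F_μ(x) − F_ν(x)| and I'_ε := [−2+ε/2, 2−ε/2]. Then Δ_ε(μ, ν) ≤ ((2γ−1)π)^{−1}·sup_{x ∈ I'_ε} | ∫_{−∞}^{x} Im( G_μ(u+iv) − G_ν(u+iv) ) du | + ((2γ−1)π)^{−1}·(1/v)·sup_{x∈ℝ} ∫_{|y|<2va} |F_ν(x) − F_ν(x+y)| dy + ((1−γ)/(2γ−1))·max{ F_ν(−2+ε), 1 − F_ν(2−ε) }. -/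
open MeasureTheory Filter Topology

section KolmogorovSmoothing

lemma cdf_nonneg (μ : Measure ℝ) (x : ℝ) : 0 ≤ cdf μ x := ENNReal.toReal_nonneg

lemma cdf_le_one (μ : Measure ℝ) [IsProbabilityMeasure μ] (x : ℝ) : cdf μ x ≤ 1 :=
  measureReal_le_one

lemma cdf_mono (μ : Measure ℝ) [IsProbabilityMeasure μ] : Monotone (cdf μ) := fun _ _ h =>
  measureReal_mono (Set.Iic_subset_Iic.2 h)

lemma abs_cdf_sub_cdf_le_one (μ ν : Measure ℝ) [IsProbabilityMeasure μ] [IsProbabilityMeasure ν]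
    (x y : ℝ) : |cdf μ x - cdf ν y| ≤ 1 := by
  have h1 := cdf_nonneg μ x
  have h2 := cdf_nonneg ν y
  have h3 := cdf_le_one μ x
  have h4 := cdf_le_one ν y
  exact abs_le.2 ⟨by linarith, by linarith⟩

lemma le_biSup_of_nonneg {s : Set ℝ} {f : ℝ → ℝ} {C : ℝ} (hf : ∀ x, 0 ≤ f x)
    (hC : ∀ x, f x ≤ C) {x : ℝ} (hx : x ∈ s) : f x ≤ ⨆ y ∈ s, f y := by
  have hC0 : 0 ≤ C := (hf x).trans (hC x)
  have hb : BddAbove (Set.range fun y => ⨆ _ : y ∈ s, f y) :=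
    ⟨C, by rintro _ ⟨y, rfl⟩; exact Real.iSup_le (fun _ => hC y) hC0⟩
  refine le_trans ?_ (le_ciSup hb x)
  simp [hx]

/-- The integral of the Poisson kernel over a half-line, after rescaling. -/
lemma setIntegral_Iic_poisson {v : ℝ} (hv : 0 < v) (x t : ℝ) :
    ∫ u in Set.Iic x, v / ((u - t) ^ 2 + v ^ 2) =
      ∫ y, (Set.Iic (x - v * y)).indicator (fun _ => (1 + y ^ 2)⁻¹) t := by
  set g : ℝ → ℝ := (Set.Iic x).indicator fun u => v / ((u - t) ^ 2 + v ^ 2) with hg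
  have h2 := Measure.integral_comp_mul_left (fun z => g (t + z)) v
  rw [integral_add_left_eq_self g t, abs_of_pos (inv_pos.2 hv), smul_eq_mul] at h2
  rw [← integral_indicator measurableSet_Iic]
  have h3 : ∫ u, g u = v * ∫ y, g (t + v * y) := by rw [h2]; field_simp
  rw [h3, ← integral_const_mul]
  refine integral_congr_ae (Eventually.of_forall fun y => ?_)
  by_cases h : t + v * y ≤ x
  · have h' : t ≤ x - v * y := by linarith
    simp only [hg, Set.indicator, Set.mem_Iic, h, h', if_true]
    have : (0 : ℝ) < 1 + y ^ 2 := by positivity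
    rw [show (t + v * y - t) ^ 2 + v ^ 2 = v ^ 2 * (1 + y ^ 2) by ring]
    field_simp
  · have h' : ¬ t ≤ x - v * y := by linarith
    simp [hg, Set.indicator, h, h']

lemma integrable_poisson {v : ℝ} (hv : 0 < v) (t : ℝ) :
    Integrable fun u : ℝ => v / ((u - t) ^ 2 + v ^ 2) := by
  have h := ((integrable_inv_one_add_sq.comp_mul_left' (inv_ne_zero hv.ne')).comp_sub_right
    t).const_mul v⁻¹
  refine h.congr (Eventually.of_forall fun u => ?_)
  have : (0 : ℝ) < (u - t) ^ 2 + v ^ 2 := by positivity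
  have h2 : (0 : ℝ) < 1 + (v⁻¹ * (u - t)) ^ 2 := by positivity
  simp only
  field_simp
  ring

lemma integral_poisson (v t : ℝ) :
    ∫ u, v / ((u - t) ^ 2 + v ^ 2) = ∫ u, v / (u ^ 2 + v ^ 2) :=
  integral_sub_right_eq_self (fun u => v / (u ^ 2 + v ^ 2)) t

lemma integrable_poisson_prod (μ : Measure ℝ) [IsProbabilityMeasure μ] {v : ℝ} (hv : 0 < v) :
    Integrable (fun p : ℝ × ℝ => v / ((p.2 - p.1) ^ 2 + v ^ 2)) (μ.prod volume) := by
  have hm : Measurable (fun p : ℝ × ℝ => v / ((p.2 - p.1) ^ 2 + v ^ 2)) := by fun_prop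
  refine (integrable_prod_iff hm.aestronglyMeasurable).2
    ⟨Eventually.of_forall fun t => integrable_poisson hv t, ?_⟩
  have hn : ∀ t u : ℝ, ‖v / ((u - t) ^ 2 + v ^ 2)‖ = v / ((u - t) ^ 2 + v ^ 2) := fun t u =>
    Real.norm_of_nonneg (by positivity)
  simp only [hn, integral_poisson v]
  exact integrable_const _

lemma cauchyG_im (μ : Measure ℝ) [IsProbabilityMeasure μ] {v : ℝ} (hv : 0 < v) (u : ℝ) :
    (cauchyG μ (u + v * Complex.I)).im = -∫ t, v / ((u - t) ^ 2 + v ^ 2) ∂μ := by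
  have hint : Integrable (fun t : ℝ => ((u : ℂ) + v * Complex.I - (t : ℂ))⁻¹) μ := by
    refine Integrable.of_bound (C := v⁻¹) (by fun_prop) (Eventually.of_forall fun t => ?_)
    rw [norm_inv]
    refine inv_anti₀ hv ?_
    have := Complex.abs_im_le_norm ((u : ℂ) + v * Complex.I - (t : ℂ))
    simpa [abs_of_pos hv] using this
  have h := integral_im (𝕜 := ℂ) hint
  simp only [RCLike.im_to_complex] at h
  rw [cauchyG, ← h, ← integral_neg]
  refine integral_congr_ae (Eventually.of_forall fun t => ?_)
  simp only [Complex.inv_im, Complex.normSq_apply]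
  simp
  ring

lemma integrable_cauchyG_im (μ : Measure ℝ) [IsProbabilityMeasure μ] {v : ℝ} (hv : 0 < v) :
    Integrable fun u : ℝ => (cauchyG μ (u + v * Complex.I)).im := by
  simp only [cauchyG_im μ hv]
  exact (integrable_poisson_prod μ hv).integral_prod_right.neg

/-- The primitive of the imaginary part of the Cauchy transform is a Cauchy average of the
distribution function. -/
lemma setIntegral_cauchyG_im (μ : Measure ℝ) [IsProbabilityMeasure μ] {v : ℝ} (hv : 0 < v)
    (x : ℝ) :
    ∫ u in Set.Iic x, (cauchyG μ (u + v * Complex.I)).im =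
      -∫ y, cdf μ (x - v * y) * (1 + y ^ 2)⁻¹ := by
  simp only [cauchyG_im μ hv]
  rw [integral_neg]
  congr 1
  have hint : Integrable (fun p : ℝ × ℝ => v / ((p.2 - p.1) ^ 2 + v ^ 2))
      (μ.prod (volume.restrict (Set.Iic x))) := by
    refine (integrable_poisson_prod μ hv).mono_measure ?_
    exact Measure.prod_mono le_rfl Measure.restrict_le_self
  have hK : Integrable (fun p : ℝ × ℝ =>
      (Set.Iic (x - v * p.2)).indicator (fun _ => (1 + p.2 ^ 2)⁻¹) p.1) (μ.prod volume) := by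
    have h1 : Integrable (fun p : ℝ × ℝ => (1 + p.2 ^ 2)⁻¹) (μ.prod volume) :=
      integrable_inv_one_add_sq.comp_snd μ
    have hs : MeasurableSet {p : ℝ × ℝ | p.1 ≤ x - v * p.2} :=
      measurableSet_le (by fun_prop) (by fun_prop)
    exact h1.indicator hs
  rw [← integral_integral_swap hint]
  simp only [setIntegral_Iic_poisson hv]
  rw [integral_integral_swap hK]
  refine integral_congr_ae (Eventually.of_forall fun y => ?_)
  simp only
  rw [integral_indicator_const _ measurableSet_Iic, smul_eq_mul]
  rfl

lemma integrable_mul_inv_one_add_sq {h : ℝ → ℝ} (hm : Measurable h) {B : ℝ}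
    (hB : ∀ y, |h y| ≤ B) : Integrable fun y => h y * (1 + y ^ 2)⁻¹ :=
  integrable_inv_one_add_sq.bdd_mul hm.aestronglyMeasurable (Eventually.of_forall hB)

lemma measurable_cdf_sub (μ : Measure ℝ) [IsProbabilityMeasure μ] (x v : ℝ) :
    Measurable fun y => cdf μ (x - v * y) :=
  (cdf_mono μ).measurable.comp (by fun_prop)

lemma setIntegral_cauchyG_sub_im (μ ν : Measure ℝ) [IsProbabilityMeasure μ]
    [IsProbabilityMeasure ν] {v : ℝ} (hv : 0 < v) (x : ℝ) :
    ∫ u in Set.Iic x, (cauchyG μ (u + v * Complex.I) - cauchyG ν (u + v * Complex.I)).im =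
      -∫ y, (cdf μ (x - v * y) - cdf ν (x - v * y)) * (1 + y ^ 2)⁻¹ := by
  have hi : ∀ (ρ : Measure ℝ) [IsProbabilityMeasure ρ],
      Integrable fun y => cdf ρ (x - v * y) * (1 + y ^ 2)⁻¹ := fun ρ _ =>
    integrable_mul_inv_one_add_sq (B := 1) (measurable_cdf_sub ρ x v) fun y => by
      rw [abs_of_nonneg (cdf_nonneg _ _)]; exact cdf_le_one _ _
  simp only [Complex.sub_im, sub_mul]
  rw [integral_sub (integrable_cauchyG_im μ hv).integrableOn
    (integrable_cauchyG_im ν hv).integrableOn, setIntegral_cauchyG_im μ hv,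
    setIntegral_cauchyG_im ν hv, integral_sub (hi μ) (hi ν)]
  ring

/-- A lower bound on a Cauchy average from a lower bound on the central window. -/
lemma le_integral_mul_inv_one_add_sq {h k : ℝ → ℝ} {s : Set ℝ} (hs : MeasurableSet s)
    (hm : Measurable h) {B c : ℝ} (hB : ∀ y, |h y| ≤ B) (hk : IntegrableOn k s)
    (hk0 : ∀ y, 0 ≤ k y) (hc : ∀ y ∈ s, c - k y ≤ h y) :
    c * (∫ y in s, (1 + y ^ 2)⁻¹) - (∫ y in s, k y)
        - B * (Real.pi - ∫ y in s, (1 + y ^ 2)⁻¹) ≤ ∫ y, h y * (1 + y ^ 2)⁻¹ := by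
  have hi := integrable_mul_inv_one_add_sq hm hB
  have hw := integrable_inv_one_add_sq
  have hsplit := integral_add_compl hs hi
  have hws := integral_add_compl hs hw
  rw [integral_univ_inv_one_add_sq] at hws
  have h1 : c * (∫ y in s, (1 + y ^ 2)⁻¹) - (∫ y in s, k y) ≤ ∫ y in s, h y * (1 + y ^ 2)⁻¹ := by
    rw [← integral_const_mul, ← integral_sub (hw.integrableOn.const_mul c) hk]
    refine setIntegral_mono_on ((hw.integrableOn.const_mul c).sub hk) hi.integrableOn hs
      fun y hy => ?_
    have hw0 : (0 : ℝ) ≤ (1 + y ^ 2)⁻¹ := by positivity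
    have hw1 : (1 + y ^ 2)⁻¹ ≤ (1 : ℝ) := inv_le_one_of_one_le₀ (by nlinarith [sq_nonneg y])
    have := mul_le_mul_of_nonneg_right (hc y hy) hw0
    have := mul_le_mul_of_nonneg_left hw1 (hk0 y)
    nlinarith
  have h2 : -B * (∫ y in sᶜ, (1 + y ^ 2)⁻¹) ≤ ∫ y in sᶜ, h y * (1 + y ^ 2)⁻¹ := by
    rw [← integral_const_mul]
    refine setIntegral_mono_on (hw.integrableOn.const_mul _) hi.integrableOn hs.compl
      fun y _ => ?_
    exact mul_le_mul_of_nonneg_right (abs_le.1 (hB y)).1 (by positivity)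
  have h3 : ∫ y in sᶜ, (1 + y ^ 2)⁻¹ = Real.pi - ∫ y in s, (1 + y ^ 2)⁻¹ := by linarith
  rw [h3] at h2
  linarith

lemma integrableOn_Ioo_of_bounded {k : ℝ → ℝ} (hm : Measurable k) {C : ℝ} (hC : ∀ y, |k y| ≤ C)
    (a b : ℝ) : IntegrableOn k (Set.Ioo a b) :=
  Measure.integrableOn_of_bounded (M := C) measure_Ioo_lt_top.ne hm.aestronglyMeasurable
    (Eventually.of_forall hC)

/-- Rescaling a window average: the image of `(-a, a)` under `y ↦ d - v y` is contained in
`(-2va, 2va)` when `|d| ≤ v a`. -/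
lemma setIntegral_comp_sub_mul_le {φ : ℝ → ℝ} (hm : Measurable φ) (h0 : ∀ y, 0 ≤ φ y) {C : ℝ}
    (hC : ∀ y, φ y ≤ C) {v a d : ℝ} (hv : 0 < v) (ha : 0 < a) (hd : |d| ≤ v * a) :
    ∫ y in Set.Ioo (-a) a, φ (d - v * y) ≤
      (1 / v) * ∫ y in Set.Ioo (-(2 * v * a)) (2 * v * a), φ y := by
  obtain ⟨hd1, hd2⟩ := abs_le.1 hd
  have hva : 0 < v * a := by positivity
  rw [← integral_Ioc_eq_integral_Ioo, ← intervalIntegral.integral_of_le (by linarith),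
    intervalIntegral.integral_comp_sub_mul _ hv.ne',
    intervalIntegral.integral_of_le (by nlinarith), integral_Ioc_eq_integral_Ioo, smul_eq_mul,
    one_div]
  refine mul_le_mul_of_nonneg_left ?_ (by positivity)
  refine setIntegral_mono_set (integrableOn_Ioo_of_bounded hm (C := C) (fun y => ?_) _ _)
    (Eventually.of_forall h0) (LE.le.eventuallyLE ?_)
  · rw [abs_of_nonneg (h0 y)]; exact hC y
  · exact Set.Ioo_subset_Ioo (by linarith) (by linarith)

/-- Outside `[l, r]` the difference of two distribution functions is controlled by its values at
the endpoints and by the tails of one of them. -/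
lemma abs_cdf_sub_le_add_tail (μ ν : Measure ℝ) [IsProbabilityMeasure μ] [IsProbabilityMeasure ν]
    {l r Δ : ℝ} (hlr : l ≤ r) (hΔ : ∀ x ∈ Set.Icc l r, |cdf μ x - cdf ν x| ≤ Δ) (x : ℝ) :
    |cdf μ x - cdf ν x| ≤ Δ + max (cdf ν l) (1 - cdf ν r) := by
  have hl := abs_le.1 (hΔ l ⟨le_rfl, hlr⟩)
  have hr := abs_le.1 (hΔ r ⟨hlr, le_rfl⟩)
  have hΔ0 : 0 ≤ Δ := (abs_nonneg _).trans (hΔ l ⟨le_rfl, hlr⟩)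
  have hM1 := le_max_left (cdf ν l) (1 - cdf ν r)
  have hM2 := le_max_right (cdf ν l) (1 - cdf ν r)
  have := cdf_nonneg ν l
  have := cdf_nonneg μ x
  have := cdf_nonneg ν x
  have := cdf_le_one μ x
  have := cdf_le_one ν x
  rcases lt_or_ge x l with h | h
  · have := cdf_mono μ h.le
    have := cdf_mono ν h.le
    exact abs_le.2 ⟨by linarith, by linarith⟩
  rcases le_or_gt x r with h' | h'
  · linarith [hΔ x ⟨h, h'⟩]
  · have := cdf_mono μ h'.le
    have := cdf_mono ν h'.le
    exact abs_le.2 ⟨by linarith, by linarith⟩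

/-- The smoothing inequality at a single point. -/
lemma abs_cdf_sub_mul_le (μ ν : Measure ℝ) [IsProbabilityMeasure μ] [IsProbabilityMeasure ν]
    {v a B I S x : ℝ} (hv : 0 < v) (ha : 0 < a) (hB : ∀ x, |cdf μ x - cdf ν x| ≤ B)
    (hI : ∀ z, |z - x| ≤ v * a →
      |∫ y, (cdf μ (z - v * y) - cdf ν (z - v * y)) * (1 + y ^ 2)⁻¹| ≤ I)
    (hS : ∫ y in Set.Ioo (-(2 * v * a)) (2 * v * a), |cdf ν x - cdf ν (x + y)| ≤ S) :
    |cdf μ x - cdf ν x| * (∫ y in Set.Ioo (-a) a, (1 + y ^ 2)⁻¹) ≤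
      I + (1 / v) * S + B * (Real.pi - ∫ y in Set.Ioo (-a) a, (1 + y ^ 2)⁻¹) := by
  have hva : 0 < v * a := by positivity
  set φ : ℝ → ℝ := fun y => |cdf ν x - cdf ν (x + y)| with hφ
  have hφm : Measurable φ := by
    have : Measurable fun y => cdf ν (x + y) := (cdf_mono ν).measurable.comp (by fun_prop)
    simp only [hφ, ← Real.norm_eq_abs]
    exact (measurable_const.sub this).norm
  have hφ0 : ∀ y, 0 ≤ φ y := fun y => abs_nonneg _
  have hφ1 : ∀ y, φ y ≤ 1 := fun y => abs_cdf_sub_cdf_le_one ν ν _ _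
  have hφi : ∀ d, IntegrableOn (fun y => φ (d - v * y)) (Set.Ioo (-a) a) := fun d =>
    integrableOn_Ioo_of_bounded (C := 1) (hφm.comp (by fun_prop))
      (fun y => (abs_of_nonneg (hφ0 (d - v * y))).le.trans (hφ1 _)) _ _
  have hφS : ∀ d, |d| ≤ v * a → ∫ y in Set.Ioo (-a) a, φ (d - v * y) ≤ (1 / v) * S := fun d hd =>
    (setIntegral_comp_sub_mul_le hφm hφ0 hφ1 hv ha hd).trans
      (mul_le_mul_of_nonneg_left hS (by positivity))
  have hm : ∀ z, Measurable fun y => cdf μ (z - v * y) - cdf ν (z - v * y) := fun z =>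
    (measurable_cdf_sub μ z v).sub (measurable_cdf_sub ν z v)
  rcases le_total 0 (cdf μ x - cdf ν x) with hpos | hneg
  · rw [abs_of_nonneg hpos]
    have hd : |v * a| ≤ v * a := (abs_of_pos hva).le
    have key := le_integral_mul_inv_one_add_sq (c := cdf μ x - cdf ν x) (s := Set.Ioo (-a) a)
      (k := fun y => φ (v * a - v * y)) measurableSet_Ioo (hm (x + v * a)) (fun y => hB _)
      (hφi _) (fun y => hφ0 _) (fun y hy => ?_)
    · have h1 := (abs_le.1 (hI (x + v * a) (by simpa using hd))).2
      have h2 := hφS _ hd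
      linarith
    · have h1 : cdf μ x ≤ cdf μ (x + v * a - v * y) := cdf_mono μ (by nlinarith [hy.2])
      have h2 := neg_abs_le (cdf ν x - cdf ν (x + (v * a - v * y)))
      simp only [hφ]
      rw [← add_sub_assoc] at h2 ⊢
      linarith
  · rw [abs_of_nonpos hneg]
    have hd : |-(v * a)| ≤ v * a := by rw [abs_neg, abs_of_pos hva]
    have key := le_integral_mul_inv_one_add_sq (c := -(cdf μ x - cdf ν x)) (s := Set.Ioo (-a) a)
      (k := fun y => φ (-(v * a) - v * y)) measurableSet_Ioo (hm (x + -(v * a))).neg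
      (fun y => by rw [Pi.neg_apply, abs_neg]; exact hB _) (hφi _) (fun y => hφ0 _)
      (fun y hy => ?_)
    · simp only [Pi.neg_apply, neg_mul _ (_⁻¹ : ℝ)] at key
      rw [integral_neg] at key
      have h1 := (abs_le.1 (hI (x + -(v * a)) (by simpa using hd))).1
      have h2 := hφS _ hd
      linarith
    · have h1 : cdf μ (x + -(v * a) - v * y) ≤ cdf μ x := cdf_mono μ (by nlinarith [hy.1])
      have h2 := le_abs_self (cdf ν x - cdf ν (x + (-(v * a) - v * y)))
      simp only [hφ, Pi.neg_apply]
      rw [← add_sub_assoc] at h2 ⊢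
      linarith

end KolmogorovSmoothing

/-- Intermediate inequality (3.2) in the proof of Bai's inequality: a bound on
`Δ_ε(μ,ν) = sup_{x ∈ [-2+ε, 2-ε]} |F_μ(x) - F_ν(x)|`. -/
theorem stmt_10 (μ ν : Measure ℝ) [IsProbabilityMeasure μ] [IsProbabilityMeasure ν]
    (hInt : Integrable (fun x => |cdf μ x - cdf ν x|))
    (v ε a γ : ℝ)
    (hv : v ∈ Set.Ioo (0 : ℝ) 1) (hε : ε ∈ Set.Ioo (0 : ℝ) 2)
    (ha : 0 < a) (hγpos : 0 < γ)
    (hγ : γ = (1 / Real.pi) * ∫ x in Set.Ioo (-a) a, 1 / (1 + x ^ 2))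
    (hγhalf : 1 / 2 < γ) (hεva : 2 * v * a < ε) :
    (⨆ x ∈ Set.Icc (-2 + ε) (2 - ε), |cdf μ x - cdf ν x|) ≤
      ((2 * γ - 1) * Real.pi)⁻¹ *
        (⨆ x ∈ Set.Icc (-2 + ε / 2) (2 - ε / 2),
          |∫ u in Set.Iic x,
            (cauchyG μ (u + v * Complex.I) - cauchyG ν (u + v * Complex.I)).im|) +
      ((2 * γ - 1) * Real.pi)⁻¹ * (1 / v) *
        (⨆ x : ℝ, ∫ y in Set.Ioo (-(2 * v * a)) (2 * v * a), |cdf ν x - cdf ν (x + y)|) +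
      ((1 - γ) / (2 * γ - 1)) * max (cdf ν (-2 + ε)) (1 - cdf ν (2 - ε)) := by
  obtain ⟨hv0, -⟩ := hv
  obtain ⟨hε0, hε2⟩ := hε
  have hpi := Real.pi_pos
  set w : ℝ := ∫ y in Set.Ioo (-a) a, (1 + y ^ 2)⁻¹ with hw
  have hγw : w = γ * Real.pi := by
    simp only [one_div] at hγ
    rw [hγ, hw]
    field_simp
  have hwpi : w ≤ Real.pi := by
    rw [← integral_univ_inv_one_add_sq]
    exact setIntegral_le_integral integrable_inv_one_add_sq
      (Eventually.of_forall fun y => by simp only [Pi.zero_apply]; positivity)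
  set J : ℝ → ℝ := fun x => |∫ u in Set.Iic x,
    (cauchyG μ (u + v * Complex.I) - cauchyG ν (u + v * Complex.I)).im| with hJ
  have hJeq : ∀ x, J x =
      |∫ y, (cdf μ (x - v * y) - cdf ν (x - v * y)) * (1 + y ^ 2)⁻¹| := fun x => by
    simp only [hJ]
    rw [setIntegral_cauchyG_sub_im μ ν hv0, abs_neg]
  have hJpi : ∀ x, J x ≤ Real.pi := fun x => by
    rw [hJeq, ← integral_univ_inv_one_add_sq, ← Real.norm_eq_abs]
    refine norm_integral_le_of_norm_le integrable_inv_one_add_sq (Eventually.of_forall fun y => ?_)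
    have hy : (0 : ℝ) ≤ (1 + y ^ 2)⁻¹ := by positivity
    rw [norm_mul, Real.norm_of_nonneg hy]
    exact mul_le_of_le_one_left hy (abs_cdf_sub_cdf_le_one μ ν _ _)
  set T : ℝ → ℝ := fun x => ∫ y in Set.Ioo (-(2 * v * a)) (2 * v * a), |cdf ν x - cdf ν (x + y)|
    with hT
  have hTb : BddAbove (Set.range T) := by
    refine ⟨1 * volume.real (Set.Ioo (-(2 * v * a)) (2 * v * a)), ?_⟩
    rintro _ ⟨x, rfl⟩
    refine (Real.le_norm_self _).trans (norm_setIntegral_le_of_norm_le_const measure_Ioo_lt_top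
      fun y _ => ?_)
    rw [Real.norm_eq_abs, abs_abs]
    exact abs_cdf_sub_cdf_le_one ν ν _ _
  set M := max (cdf ν (-2 + ε)) (1 - cdf ν (2 - ε)) with hM
  have hM0 : 0 ≤ M := (cdf_nonneg ν _).trans (le_max_left _ _)
  set I := ⨆ x ∈ Set.Icc (-2 + ε / 2) (2 - ε / 2), J x with hI
  have hJI : ∀ x ∈ Set.Icc (-2 + ε / 2) (2 - ε / 2), J x ≤ I := fun x hx =>
    le_biSup_of_nonneg (fun _ => abs_nonneg _) hJpi hx
  have hI0 : 0 ≤ I := Real.iSup_nonneg fun _ => Real.iSup_nonneg fun _ => abs_nonneg _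
  set S := ⨆ x, T x with hS
  have hS0 : 0 ≤ S := Real.iSup_nonneg fun _ => integral_nonneg fun _ => abs_nonneg _
  set Δ := ⨆ x ∈ Set.Icc (-2 + ε) (2 - ε), |cdf μ x - cdf ν x| with hΔ
  have hΔ0 : 0 ≤ Δ := Real.iSup_nonneg fun _ => Real.iSup_nonneg fun _ => abs_nonneg _
  have hDΔ : ∀ x ∈ Set.Icc (-2 + ε) (2 - ε), |cdf μ x - cdf ν x| ≤ Δ := fun x hx =>
    le_biSup_of_nonneg (f := fun x => |cdf μ x - cdf ν x|) (fun _ => abs_nonneg _)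
      (fun _ => abs_cdf_sub_cdf_le_one μ ν _ _) hx
  have hB := abs_cdf_sub_le_add_tail μ ν (show -2 + ε ≤ 2 - ε by linarith) hDΔ
  set R := I + (1 / v) * S + (Δ + M) * (Real.pi - w) with hR
  have hw0 : 0 < w := by rw [hγw]; positivity
  have hR0 : 0 ≤ R := by
    have : 0 ≤ Real.pi - w := sub_nonneg.2 hwpi
    positivity
  have hpt : ∀ x ∈ Set.Icc (-2 + ε) (2 - ε), |cdf μ x - cdf ν x| ≤ R / w := fun x hx => by
    rw [le_div_iff₀ hw0]
    refine abs_cdf_sub_mul_le μ ν hv0 ha hB (fun z hz => ?_) (le_ciSup hTb x)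
    rw [← hJeq]
    obtain ⟨hz1, hz2⟩ := abs_le.1 hz
    exact hJI z ⟨by linarith [hx.1], by linarith [hx.2]⟩
  have hΔR : Δ ≤ R / w :=
    Real.iSup_le (fun x => Real.iSup_le (hpt x) (by positivity)) (by positivity)
  rw [le_div_iff₀ hw0, hR, hγw] at hΔR
  have h2γ : 0 < 2 * γ - 1 := by linarith
  have hrhs : ((2 * γ - 1) * Real.pi)⁻¹ * I + ((2 * γ - 1) * Real.pi)⁻¹ * (1 / v) * S +
      ((1 - γ) / (2 * γ - 1)) * M =
      (I + (1 / v) * S + (1 - γ) * Real.pi * M) / ((2 * γ - 1) * Real.pi) := by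
    field_simp
  rw [hrhs, le_div_iff₀ (by positivity)]
  linarith
end

section
/- Let (A, φ) be a C*-probability space with faithful tracial φ and let s_1, …, s_n be free standard semicircular elements of A. Then ‖ (1/n)·∑_{i=1}^n s_i² − 1 ‖ = 2/√n + 1/n, and the spectrum of (1/n)·∑_{i=1}^n s_i² equals the interval [1 − 2/√n + 1/n, 1 + 2/√n + 1/n]. -/
open MeasureTheory Filter Topology

namespace FreeSemicircular

open Polynomial Polynomial.Chebyshev

/-- The expectation of `f` under the semicircle law, in the angular variable `t = 2 cos θ`. -/
noncomputable def semi (f : ℝ → ℝ) : ℝ :=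
  2 / Real.pi * ∫ θ in (0 : ℝ)..Real.pi, f (2 * Real.cos θ) * Real.sin θ ^ 2

theorem integral_semicircleLaw {f : ℝ → ℝ} (hf : Continuous f) :
    ∫ t, f t ∂semicircleLaw = semi f := by
  have hmeas : Measurable fun t : ℝ => ENNReal.ofReal (Set.indicator (Set.Icc (-2 : ℝ) 2)
      (fun t => (2 * Real.pi)⁻¹ * Real.sqrt (4 - t ^ 2)) t) := by
    refine ENNReal.measurable_ofReal.comp (Measurable.indicator ?_ measurableSet_Icc)
    exact Continuous.measurable (by fun_prop)
  unfold semicircleLaw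
  rw [integral_withDensity_eq_integral_toReal_smul hmeas
    (Filter.Eventually.of_forall fun _ => ENNReal.ofReal_lt_top)]
  have h1 : ∀ t : ℝ, (ENNReal.ofReal (Set.indicator (Set.Icc (-2 : ℝ) 2)
      (fun t => (2 * Real.pi)⁻¹ * Real.sqrt (4 - t ^ 2)) t)).toReal • f t =
      Set.indicator (Set.Icc (-2 : ℝ) 2)
        (fun t => (2 * Real.pi)⁻¹ * Real.sqrt (4 - t ^ 2) * f t) t := by
    intro t
    rw [ENNReal.toReal_ofReal (Set.indicator_nonneg (fun _ _ => by positivity) t)]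
    by_cases ht : t ∈ Set.Icc (-2 : ℝ) 2 <;> simp [ht]
  simp_rw [h1]
  rw [integral_indicator measurableSet_Icc, integral_Icc_eq_integral_Ioc,
    ← intervalIntegral.integral_of_le (by norm_num)]
  have h2 := intervalIntegral.integral_comp_mul_deriv (a := 0) (b := Real.pi)
    (f := fun θ => 2 * Real.cos θ) (f' := fun θ => 2 * -Real.sin θ)
    (g := fun t => (2 * Real.pi)⁻¹ * Real.sqrt (4 - t ^ 2) * f t)
    (fun x _ => (Real.hasDerivAt_cos x).const_mul 2) (by fun_prop) (by fun_prop)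
  simp only [Real.cos_zero, Real.cos_pi, mul_one, mul_neg] at h2
  rw [intervalIntegral.integral_symm, ← h2, semi, ← intervalIntegral.integral_neg,
    ← intervalIntegral.integral_const_mul]
  refine intervalIntegral.integral_congr fun θ hθ => ?_
  rw [Set.uIcc_of_le Real.pi_pos.le] at hθ
  have hs : 0 ≤ Real.sin θ := Real.sin_nonneg_of_mem_Icc hθ
  have h3 : Real.sqrt (4 - (2 * Real.cos θ) ^ 2) = 2 * Real.sin θ := by
    rw [← Real.sqrt_sq (by positivity : 0 ≤ 2 * Real.sin θ)]
    congr 1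
    nlinarith [Real.sin_sq_add_cos_sq θ]
  have := Real.pi_pos
  simp only [Function.comp, h3]
  field_simp

theorem integral_sin_natCast_mul_sin (k : ℕ) :
    ∫ θ in (0 : ℝ)..Real.pi, Real.sin ((k + 1) * θ) * Real.sin θ =
      if k = 0 then Real.pi / 2 else 0 := by
  split_ifs with hk
  · subst hk
    simp [← sq, integral_sin_sq]
  · have h : ∀ θ : ℝ, Real.sin ((k + 1) * θ) * Real.sin θ =
        2⁻¹ * (Real.cos (k * θ) - Real.cos ((k + 2) * θ)) := by
      intro θ
      rw [Real.cos_sub_cos, show ((k : ℝ) * θ + (k + 2) * θ) / 2 = (k + 1) * θ by ring,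
        show ((k : ℝ) * θ - (k + 2) * θ) / 2 = -θ by ring, Real.sin_neg]
      ring
    have hk' : (k : ℝ) ≠ 0 := by exact_mod_cast hk
    have hk2 : (k : ℝ) + 2 ≠ 0 := by positivity
    have e : ((k : ℝ) + 2) * Real.pi = ((k + 2 : ℕ) : ℝ) * Real.pi := by push_cast; ring
    simp_rw [h]
    rw [intervalIntegral.integral_const_mul, intervalIntegral.integral_sub
      (Continuous.intervalIntegrable (by fun_prop) _ _)
      (Continuous.intervalIntegrable (by fun_prop) _ _),
      intervalIntegral.integral_comp_mul_left _ hk', intervalIntegral.integral_comp_mul_left _ hk2,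
      integral_cos, integral_cos, e, Real.sin_nat_mul_pi, Real.sin_nat_mul_pi]
    simp

theorem semi_chebyshev (k : ℕ) :
    semi (fun t => (S ℝ k).eval t) = if k = 0 then 1 else 0 := by
  have h : ∀ θ : ℝ, (S ℝ k).eval (2 * Real.cos θ) * Real.sin θ ^ 2 =
      Real.sin ((k + 1) * θ) * Real.sin θ := by
    intro θ
    have := S_two_mul_real_cos θ k
    push_cast at this
    rw [← this]
    ring
  have := Real.pi_pos
  simp only [semi, h, integral_sin_natCast_mul_sin]
  split_ifs
  · field_simp
  · simp

/-- The Stieltjes transform of the semicircle law at `r + r⁻¹`. -/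
theorem integral_sin_sq_div {r : ℝ} (hr0 : 0 ≤ r) (hr : r < 1) :
    ∫ θ in (0 : ℝ)..Real.pi, Real.sin θ ^ 2 / (1 + 2 * r * Real.cos θ + r ^ 2) =
      Real.pi / 2 := by
  have hD : ∀ θ, (1 - r) ^ 2 ≤ 1 + 2 * r * Real.cos θ + r ^ 2 := fun θ => by
    nlinarith [Real.neg_one_le_cos θ]
  have hp : 0 < (1 - r) ^ 2 := by nlinarith
  have hD0 : ∀ θ, 1 + 2 * r * Real.cos θ + r ^ 2 ≠ 0 := fun θ => (hp.trans_le (hD θ)).ne'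
  set J : ℕ → ℝ := fun k => ∫ θ in (0 : ℝ)..Real.pi,
    Real.sin (k * θ) * Real.sin θ / (1 + 2 * r * Real.cos θ + r ^ 2) with hJ
  have hint : ∀ k : ℕ, IntervalIntegrable (fun θ => Real.sin (k * θ) * Real.sin θ /
      (1 + 2 * r * Real.cos θ + r ^ 2)) volume 0 Real.pi := fun k =>
    Continuous.intervalIntegrable (by fun_prop (disch := exact hD0 _)) _ _
  have hrec : ∀ k : ℕ, r * (J (k + 2) + r * J (k + 1)) + (J (k + 1) + r * J k) =
      if k = 0 then Real.pi / 2 else 0 := by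
    intro k
    rw [← integral_sin_natCast_mul_sin]
    have : r * (J (k + 2) + r * J (k + 1)) + (J (k + 1) + r * J k) =
        r * J (k + 2) + (r ^ 2 + 1) * J (k + 1) + r * J k := by ring
    rw [this, hJ]
    simp only
    rw [← intervalIntegral.integral_const_mul, ← intervalIntegral.integral_const_mul,
      ← intervalIntegral.integral_const_mul,
      ← intervalIntegral.integral_add ((hint _).const_mul _) ((hint _).const_mul _),
      ← intervalIntegral.integral_add
        (((hint _).const_mul _).add ((hint _).const_mul _)) ((hint _).const_mul _)]
    refine intervalIntegral.integral_congr fun θ _ => ?_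
    have e : Real.sin ((k + 2 : ℕ) * θ) + Real.sin (k * θ) =
        2 * Real.cos θ * Real.sin ((k + 1) * θ) := by
      rw [Real.sin_add_sin, show (((k + 2 : ℕ) : ℝ) * θ + k * θ) / 2 = (k + 1) * θ by
        push_cast; ring, show (((k + 2 : ℕ) : ℝ) * θ - k * θ) / 2 = θ by push_cast; ring]
      ring
    rw [← eq_sub_iff_add_eq] at e
    simp only [e]
    push_cast
    obtain ⟨D, hDdef⟩ : ∃ D, D = 1 + 2 * r * Real.cos θ + r ^ 2 := ⟨_, rfl⟩
    have e' : D ≠ 0 := hDdef ▸ hD0 θ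
    rw [← hDdef]
    field_simp
    rw [hDdef]
    ring
  have hbd : ∀ k, |J (k + 1) + r * J k| ≤ 2 * (((1 - r) ^ 2)⁻¹ * Real.pi) := by
    have hJb : ∀ k, |J k| ≤ ((1 - r) ^ 2)⁻¹ * Real.pi := by
      intro k
      have := intervalIntegral.norm_integral_le_of_norm_le_const (a := 0) (b := Real.pi)
        (C := ((1 - r) ^ 2)⁻¹) (f := fun θ => Real.sin (k * θ) * Real.sin θ /
          (1 + 2 * r * Real.cos θ + r ^ 2)) ?_
      · simpa [abs_of_pos Real.pi_pos] using this
      · intro θ _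
        rw [Real.norm_eq_abs, abs_div, abs_mul, abs_of_pos (hp.trans_le (hD θ)), div_eq_mul_inv]
        have h1 : |Real.sin (k * θ)| * |Real.sin θ| ≤ 1 :=
          mul_le_one₀ (Real.abs_sin_le_one _) (abs_nonneg _) (Real.abs_sin_le_one _)
        calc _ ≤ 1 * ((1 - r) ^ 2)⁻¹ := by
              rw [← div_eq_mul_inv, ← div_eq_mul_inv]
              gcongr
              exact hD θ
          _ = _ := one_mul _
    intro k
    calc _ ≤ |J (k + 1)| + |r * J k| := abs_add_le _ _
      _ ≤ _ := by
        rw [abs_mul, abs_of_nonneg hr0]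
        nlinarith [hJb k, hJb (k + 1), abs_nonneg (J k)]
  have hpow : ∀ k, J 2 + r * J 1 = (-r) ^ k * (J (k + 2) + r * J (k + 1)) := by
    intro k
    induction k with
    | zero => simp
    | succ k ih =>
      have := hrec (k + 1)
      simp only [Nat.add_eq_zero_iff, one_ne_zero, and_false, if_false] at this
      rw [ih, pow_succ]
      linear_combination (-r) ^ k * this
  have h0 : J 2 + r * J 1 = 0 := by
    have ht : Tendsto (fun k : ℕ => r ^ k * (2 * (((1 - r) ^ 2)⁻¹ * Real.pi))) atTop (𝓝 0) := by
      simpa using (tendsto_pow_atTop_nhds_zero_of_lt_one hr0 hr).mul_const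
        (2 * (((1 - r) ^ 2)⁻¹ * Real.pi))
    have : |J 2 + r * J 1| ≤ 0 := by
      refine ge_of_tendsto' ht fun k => ?_
      rw [hpow k, abs_mul, abs_pow, abs_neg, abs_of_nonneg hr0]
      gcongr
      exact hbd (k + 1)
    exact abs_nonpos_iff.mp this
  have h1 := hrec 0
  have hJ0 : J 0 = 0 := by simp [hJ]
  simp only [zero_add, h0, hJ0, mul_zero, add_zero, if_true] at h1
  rw [← h1, hJ]
  simp [sq]
section Words

variable {A : Type*} [Ring A]

/-- The element of `A` sending the vacuum to the basis vector `w` of the full Fock space,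
written in terms of the semicircular elements `s i`. -/
def wick (s : ℕ → A) : List ℕ → A
  | [] => 1
  | [i] => s i
  | i :: j :: w => s i * wick s (j :: w) - if i = j then wick s w else 0

theorem wick_replicate_append [Algebra ℂ A] (s : ℕ → A) (i : ℕ) (w : List ℕ) (hw : w.head? ≠ some i) (k : ℕ) :
    wick s (List.replicate k i ++ w) = aeval (s i) (S ℂ k) * wick s w ∧
    wick s (List.replicate (k + 1) i ++ w) = aeval (s i) (S ℂ (k + 1)) * wick s w := by
  induction k with
  | zero =>
    cases w with
    | nil => simp [wick]
    | cons j w =>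
      have : i ≠ j := fun h => hw (by simp [h])
      simp [wick, this]
  | succ k ih =>
    refine ⟨by exact_mod_cast ih.2, ?_⟩
    have h : List.replicate (k + 1 + 1) i ++ w = i :: i :: (List.replicate k i ++ w) := rfl
    have h' : i :: (List.replicate k i ++ w) = List.replicate (k + 1) i ++ w := rfl
    rw [h, wick, if_pos rfl, h', ih.1, ih.2]
    push_cast
    rw [add_assoc, one_add_one_eq_two, S_add_two]
    simp [sub_mul, mul_assoc]

theorem exists_eq_replicate_append (i : ℕ) (w : List ℕ) :
    ∃ k w', i :: w = List.replicate (k + 1) i ++ w' ∧ w'.head? ≠ some i := by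
  induction w with
  | nil => exact ⟨0, [], by simp⟩
  | cons j w ih =>
    by_cases h : j = i
    · obtain ⟨k, w', h1, h2⟩ := ih
      exact ⟨k + 1, w', by rw [h, h1]; rfl, h2⟩
    · exact ⟨0, j :: w, by simp [h]⟩

theorem map_prod_eq_zero_of_isChain [Algebra ℂ A] {φ : A →ₗ[ℂ] ℂ} {s : ℕ → A} (hfree : AreFree φ s)
    (l : List (ℕ × A)) (hl : l ≠ []) (hc : l.IsChain fun a b => a.1 ≠ b.1)
    (hmem : ∀ a ∈ l, a.2 ∈ Algebra.adjoin ℂ {s a.1} ∧ φ a.2 = 0) :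
    φ (l.map Prod.snd).prod = 0 := by
  obtain ⟨k, hk⟩ : ∃ k, l.length = k + 1 :=
    Nat.exists_eq_succ_of_ne_zero (by simpa using hl)
  have := hfree k (fun j => (l.get (j.cast hk.symm)).1) (fun j => by
      rw [List.isChain_iff_getElem] at hc
      exact hc j (by omega)) (fun j => (l.get (j.cast hk.symm)).2)
    (fun j => (hmem _ (List.get_mem _ _)).1) (fun j => (hmem _ (List.get_mem _ _)).2)
  convert this using 2
  congr 1
  refine List.ext_getElem (by simp [hk]) fun m h1 h2 => by
    simp only [List.getElem_map, List.getElem_ofFn, List.get_eq_getElem, Fin.val_cast]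

theorem map_wick_eq_zero [Algebra ℂ A] {φ : A →ₗ[ℂ] ℂ} {s : ℕ → A} (hfree : AreFree φ s)
    (hcent : ∀ i (k : ℕ), φ (aeval (s i) (S ℂ (k + 1))) = 0) (w : List ℕ) (hw : w ≠ []) :
    φ (wick s w) = 0 := by
  have key : ∀ (m : ℕ) (w : List ℕ), w.length ≤ m → ∃ l : List (ℕ × A),
      (l.head?.map Prod.fst = w.head?) ∧ (l.IsChain fun a b => a.1 ≠ b.1) ∧
      (∀ a ∈ l, a.2 ∈ Algebra.adjoin ℂ {s a.1} ∧ φ a.2 = 0) ∧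
      wick s w = (l.map Prod.snd).prod := by
    intro m
    induction m with
    | zero =>
      intro w hw
      have : w = [] := by simpa using hw
      exact ⟨[], by simp [this, wick]⟩
    | succ m ih =>
      intro w hw
      cases w with
      | nil => exact ⟨[], by simp [wick]⟩
      | cons i w =>
        obtain ⟨k, w', h1, h2⟩ := exists_eq_replicate_append i w
        have hlen : w'.length ≤ m := by
          rw [h1] at hw
          simp at hw
          omega
        obtain ⟨l, hl1, hl2, hl3, hl4⟩ := ih w' hlen
        refine ⟨(i, aeval (s i) (S ℂ (k + 1))) :: l, by simp, ?_, ?_, ?_⟩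
        · cases l with
          | nil => simp
          | cons a l =>
            rw [List.isChain_cons_cons]
            refine ⟨fun h => h2 ?_, hl2⟩
            rw [← hl1]
            simp at h ⊢
            exact h.symm
        · intro a ha
          rcases List.mem_cons.mp ha with rfl | ha
          · exact ⟨aeval_mem_adjoin_singleton ℂ (s i), hcent i k⟩
          · exact hl3 a ha
        · rw [h1, (wick_replicate_append s i w' h2 k).2, hl4]
          simp
  obtain ⟨l, hl1, hl2, hl3, hl4⟩ := key _ w le_rfl
  rw [hl4]
  refine map_prod_eq_zero_of_isChain hfree l ?_ hl2 hl3
  rintro rfl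
  cases w <;> simp_all

/-- Sum of `g` over all words `i₁ i₁ i₂ i₂ ⋯ iₖ iₖ` with letters less than `n`. -/
def sumDoubled (n : ℕ) : ℕ → (List ℕ → A) → A
  | 0, g => g []
  | k + 1, g => ∑ i ∈ Finset.range n, sumDoubled n k fun w => g (i :: i :: w)

theorem sumDoubled_add (n k : ℕ) (f g : List ℕ → A) :
    sumDoubled n k (fun w => f w + g w) = sumDoubled n k f + sumDoubled n k g := by
  induction k generalizing f g with
  | zero => rfl
  | succ k ih => simp [sumDoubled, ih, Finset.sum_add_distrib]

theorem sumDoubled_mul_left (n k : ℕ) (a : A) (g : List ℕ → A) :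
    sumDoubled n k (fun w => a * g w) = a * sumDoubled n k g := by
  induction k generalizing g with
  | zero => rfl
  | succ k ih => simp [sumDoubled, ih, Finset.mul_sum]

theorem sumDoubled_sum (n k : ℕ) (t : Finset ℕ) (g : ℕ → List ℕ → A) :
    sumDoubled n k (fun w => ∑ i ∈ t, g i w) = ∑ i ∈ t, sumDoubled n k (g i) := by
  induction k generalizing g with
  | zero => rfl
  | succ k ih =>
    simp only [sumDoubled, ih]
    exact Finset.sum_comm

theorem map_sumDoubled_eq_zero [Algebra ℂ A] (φ : A →ₗ[ℂ] ℂ) (n k : ℕ) (g : List ℕ → A)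
    (hg : ∀ w, φ (g w) = 0) : φ (sumDoubled n k g) = 0 := by
  induction k generalizing g with
  | zero => exact hg _
  | succ k ih =>
    rw [sumDoubled, map_sum]
    exact Finset.sum_eq_zero fun i _ => ih _ fun w => hg _

theorem sumSq_mul_wick (s : ℕ → A) (n j : ℕ) (hj : j ∈ Finset.range n) (w : List ℕ) :
    (∑ i ∈ Finset.range n, s i ^ 2) * wick s (j :: j :: w) =
      ∑ i ∈ Finset.range n, wick s (i :: i :: j :: j :: w) +
        ((n + 1 : A) * wick s (j :: j :: w) + wick s w) := by
  have h : ∀ i, s i ^ 2 * wick s (j :: j :: w) = wick s (i :: i :: j :: j :: w) +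
      (wick s (j :: j :: w) + if i = j then wick s (j :: j :: w) + wick s w else 0) := by
    intro i
    by_cases hij : i = j
    · subst hij
      simp only [wick, if_true]
      noncomm_ring
    · simp only [wick, if_true, if_neg hij]
      noncomm_ring
  rw [Finset.sum_mul, Finset.sum_congr rfl fun i _ => h i, Finset.sum_add_distrib,
    Finset.sum_add_distrib, Finset.sum_ite_eq' (Finset.range n) j, if_pos hj]
  simp [add_mul, add_assoc]

theorem sumSq_mul_sumDoubled (s : ℕ → A) (n k : ℕ) :
    (∑ i ∈ Finset.range n, s i ^ 2) * sumDoubled n (k + 1) (wick s) =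
      sumDoubled n (k + 2) (wick s) + (n + 1 : A) * sumDoubled n (k + 1) (wick s) +
        n * sumDoubled n k (wick s) := by
  have h : (∑ i ∈ Finset.range n, s i ^ 2) * sumDoubled n (k + 1) (wick s) =
      ∑ j ∈ Finset.range n, (∑ i ∈ Finset.range n,
        sumDoubled n k (fun w => wick s (i :: i :: j :: j :: w)) +
        ((n + 1 : A) * sumDoubled n k (fun w => wick s (j :: j :: w)) +
          sumDoubled n k (wick s))) := by
    rw [sumDoubled, Finset.mul_sum]
    refine Finset.sum_congr rfl fun j hj => ?_
    rw [← sumDoubled_mul_left]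
    simp_rw [sumSq_mul_wick s n j hj]
    rw [sumDoubled_add, sumDoubled_add, sumDoubled_mul_left, sumDoubled_sum]
  rw [h, Finset.sum_add_distrib, Finset.sum_add_distrib, Finset.sum_comm, ← Finset.mul_sum]
  simp [sumDoubled, add_assoc]

theorem sumDoubled_one (s : ℕ → A) (n : ℕ) :
    sumDoubled n 1 (wick s) = ∑ i ∈ Finset.range n, s i ^ 2 - n := by
  simp [sumDoubled, wick, sq]

end Words

/-- Monic rescaled Chebyshev polynomials of the second kind, orthogonal for the semicircle law with
mean `n + 1` and variance `n`. -/
noncomputable def shiftCheb (n : ℕ) : ℕ → ℝ[X]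
  | 0 => 1
  | 1 => X - C (n + 1 : ℝ)
  | k + 2 => (X - C (n + 1 : ℝ)) * shiftCheb n (k + 1) - C (n : ℝ) * shiftCheb n k

theorem eval_shiftCheb (n k : ℕ) (t : ℝ) :
    (shiftCheb n k).eval (n + 1 + Real.sqrt n * t) = Real.sqrt n ^ k * (S ℝ k).eval t := by
  induction k using Nat.twoStepInduction with
  | zero => simp [shiftCheb]
  | one => simp [shiftCheb]
  | more k h0 h1 =>
    have hn : Real.sqrt n ^ 2 = n := Real.sq_sqrt n.cast_nonneg
    simp only [shiftCheb, eval_sub, eval_mul, eval_X, eval_C, h0, h1]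
    push_cast
    rw [S_add_two]
    simp only [eval_sub, eval_mul, eval_X]
    nth_rw 5 [← hn]
    ring

theorem mem_span_shiftCheb (n : ℕ) (p : ℝ[X]) :
    p ∈ Submodule.span ℝ (Set.range (shiftCheb n)) := by
  have hX : ∀ q ∈ Submodule.span ℝ (Set.range (shiftCheb n)),
      X * q ∈ Submodule.span ℝ (Set.range (shiftCheb n)) := by
    intro q hq
    induction hq using Submodule.span_induction with
    | mem q hq =>
      obtain ⟨k, rfl⟩ := hq
      cases k with
      | zero =>
        have : X * shiftCheb n 0 = shiftCheb n 1 + (n + 1 : ℝ) • shiftCheb n 0 := by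
          simp [shiftCheb, smul_eq_C_mul]
        rw [this]
        exact add_mem (Submodule.subset_span ⟨_, rfl⟩)
          (Submodule.smul_mem _ _ (Submodule.subset_span ⟨_, rfl⟩))
      | succ k =>
        have : X * shiftCheb n (k + 1) = shiftCheb n (k + 2) +
            (n + 1 : ℝ) • shiftCheb n (k + 1) + (n : ℝ) • shiftCheb n k := by
          simp only [shiftCheb, smul_eq_C_mul]
          ring
        rw [this]
        exact add_mem (add_mem (Submodule.subset_span ⟨_, rfl⟩)
          (Submodule.smul_mem _ _ (Submodule.subset_span ⟨_, rfl⟩)))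
          (Submodule.smul_mem _ _ (Submodule.subset_span ⟨_, rfl⟩))
    | zero => simp
    | add x y _ _ hx hy => rw [mul_add]; exact add_mem hx hy
    | smul a x _ hx => rw [mul_smul_comm]; exact Submodule.smul_mem _ _ hx
  induction p using Polynomial.induction_on with
  | C a =>
    have : C a = a • shiftCheb n 0 := by simp [shiftCheb, smul_eq_C_mul]
    rw [this]
    exact Submodule.smul_mem _ _ (Submodule.subset_span ⟨_, rfl⟩)
  | add p q hp hq => exact add_mem hp hq
  | monomial k a h =>
    rw [pow_succ, ← mul_assoc, mul_comm]
    exact hX _ h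

theorem semi_add {f g : ℝ → ℝ} (hf : Continuous f) (hg : Continuous g) :
    semi (fun t => f t + g t) = semi f + semi g := by
  simp only [semi, add_mul]
  rw [intervalIntegral.integral_add (Continuous.intervalIntegrable (by fun_prop) _ _)
    (Continuous.intervalIntegrable (by fun_prop) _ _), mul_add]

theorem semi_const_mul (c : ℝ) (f : ℝ → ℝ) : semi (fun t => c * f t) = c * semi f := by
  simp only [semi, mul_assoc]
  rw [intervalIntegral.integral_const_mul]
  ring

theorem semi_const (c : ℝ) : semi (fun _ => c) = c := by
  have := semi_chebyshev 0
  simp only [Nat.cast_zero, S_zero, eval_one, if_true] at this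
  simpa [this] using semi_const_mul c fun _ => 1

theorem semi_mono {f g : ℝ → ℝ} (hf : Continuous f) (hg : Continuous g)
    (h : ∀ t ∈ Set.Icc (-2 : ℝ) 2, f t ≤ g t) : semi f ≤ semi g := by
  unfold semi
  refine mul_le_mul_of_nonneg_left ?_ (by positivity)
  refine intervalIntegral.integral_mono Real.pi_pos.le
    (Continuous.intervalIntegrable (by fun_prop) _ _)
    (Continuous.intervalIntegrable (by fun_prop) _ _) fun θ => ?_
  refine mul_le_mul_of_nonneg_right (h _ ⟨?_, ?_⟩) (by positivity)
  · linarith [Real.neg_one_le_cos θ]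
  · linarith [Real.cos_le_one θ]

theorem semi_shiftCheb (n k : ℕ) :
    semi (fun t => (shiftCheb n k).eval (n + 1 + Real.sqrt n * t)) = if k = 0 then 1 else 0 := by
  simp_rw [eval_shiftCheb]
  rw [semi_const_mul, semi_chebyshev]
  split_ifs with h <;> simp [h]

section Moments

variable {A : Type*} [Ring A]

theorem aeval_shiftCheb [Algebra ℝ A] (s : ℕ → A) (n k : ℕ) :
    aeval (∑ i ∈ Finset.range n, s i ^ 2) (shiftCheb n (k + 1)) +
      aeval (∑ i ∈ Finset.range n, s i ^ 2) (shiftCheb n k) =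
      sumDoubled n (k + 1) (wick s) := by
  induction k using Nat.twoStepInduction with
  | zero =>
    simp [shiftCheb, sumDoubled_one]
    abel
  | one =>
    have h := sumSq_mul_sumDoubled s n 0
    rw [zero_add, sumDoubled_one] at h
    rw [← sub_eq_iff_eq_add, ← sub_eq_iff_eq_add] at h
    rw [show 1 + 1 = 0 + 2 from rfl, ← h]
    simp [shiftCheb, sumDoubled, wick]
    noncomm_ring
  | more k h0 h1 =>
    have h := sumSq_mul_sumDoubled s n (k + 1)
    rw [← sub_eq_iff_eq_add, ← sub_eq_iff_eq_add] at h
    rw [show k + 2 + 1 = k + 1 + 2 from rfl, ← h, ← h0, ← h1]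
    simp [shiftCheb]
    noncomm_ring

theorem map_mul_aeval_shiftCheb [Algebra ℂ A] [Algebra ℝ A] {φ : A →ₗ[ℂ] ℂ} (h1 : φ 1 = 1)
    {s : ℕ → A} {n : ℕ} (h0 : ∀ k, φ (sumDoubled n (k + 1) (wick s)) = 0) (k : ℕ) :
    φ ((∑ i ∈ Finset.range n, s i ^ 2) *
      aeval (∑ i ∈ Finset.range n, s i ^ 2) (shiftCheb n k)) = if k = 0 then (n : ℂ) else 0 := by
  have hn : ∀ x : A, φ (n * x) = n * φ x := fun x => by
    rw [← nsmul_eq_mul, map_nsmul, nsmul_eq_mul]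
  cases k with
  | zero =>
    have h := h0 0
    rw [zero_add, sumDoubled_one, map_sub, sub_eq_zero] at h
    rw [shiftCheb, map_one, mul_one, h, if_pos rfl, ← mul_one (n : A), hn, h1, mul_one]
  | succ k =>
    have h : (∑ i ∈ Finset.range n, s i ^ 2) *
        aeval (∑ i ∈ Finset.range n, s i ^ 2) (shiftCheb n (k + 1)) =
        sumDoubled n (k + 2) (wick s) + n * sumDoubled n (k + 1) (wick s) := by
      rw [← aeval_shiftCheb s n k, ← aeval_shiftCheb s n (k + 1)]
      simp [shiftCheb]
      noncomm_ring
    rw [h, map_add, hn, h0, h0]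
    simp

theorem map_aeval_chebyshev [StarRing A] [Algebra ℂ A] {φ : A →ₗ[ℂ] ℂ} {x : A}
    (hx : IsStdSemicircular φ x) (k : ℕ) : φ (aeval x (S ℂ (k + 1))) = 0 := by
  have h : ∀ p : ℝ[X], φ (aeval x (p.map Complex.ofRealHom)) = (semi fun t => p.eval t : ℝ) := by
    intro p
    induction p using Polynomial.induction_on' with
    | add p q hp hq =>
      simp only [Polynomial.map_add, map_add, hp, hq, eval_add]
      rw [semi_add p.continuous q.continuous]
      push_cast
      rfl
    | monomial m a =>
      simp only [map_monomial, aeval_monomial, eval_monomial, ← Algebra.smul_def, map_smul, hx.2 m]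
      rw [semi_const_mul, integral_semicircleLaw (by fun_prop)]
      simp
  have h2 := h (S ℝ (k + 1 : ℕ))
  rw [semi_chebyshev, map_S] at h2
  simpa using h2

end Moments

section CStar

variable {A : Type*} [CStarAlgebra A] {φ : A →ₗ[ℂ] ℂ} {s : ℕ → A} {n : ℕ}

theorem isSelfAdjoint_sumSq (hs : ∀ i, IsSelfAdjoint (s i)) :
    IsSelfAdjoint (∑ i ∈ Finset.range n, s i ^ 2) :=
  isSelfAdjoint_sum _ fun i _ => (hs i).pow 2

theorem map_sumSq_mul_eq_sum (hTr : IsTracial φ) (x : A) :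
    φ ((∑ i ∈ Finset.range n, s i ^ 2) * x) = ∑ i ∈ Finset.range n, φ (s i * x * s i) := by
  rw [Finset.sum_mul, map_sum]
  refine Finset.sum_congr rfl fun i _ => ?_
  rw [hTr (s i * x), sq, mul_assoc]

theorem re_map_sumSq_mul_cfc_nonneg (hφ : IsState φ) (hTr : IsTracial φ)
    (hs : ∀ i, IsSelfAdjoint (s i)) {a : A} {f : ℝ → ℝ} (hf : Continuous f)
    (h : ∀ x ∈ spectrum ℝ a, 0 ≤ f x) :
    0 ≤ (φ ((∑ i ∈ Finset.range n, s i ^ 2) * cfc f a)).re := by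
  rw [map_sumSq_mul_eq_sum hTr, Complex.re_sum]
  refine Finset.sum_nonneg fun i _ => ?_
  have h1 : cfc f a = cfc (fun x => Real.sqrt (f x)) a * cfc (fun x => Real.sqrt (f x)) a := by
    rw [← cfc_mul _ _ a (by fun_prop) (by fun_prop)]
    exact cfc_congr fun x hx => (Real.mul_self_sqrt (h x hx)).symm
  have h2 : s i * cfc f a * s i = star (cfc (fun x => Real.sqrt (f x)) a * s i) *
      (cfc (fun x => Real.sqrt (f x)) a * s i) := by
    rw [star_mul, (hs i).star_eq, (cfc_predicate _ a : IsSelfAdjoint _).star_eq, h1]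
    noncomm_ring
  rw [h2]
  exact (hφ.2 _).1

theorem abs_re_map_sumSq_mul_cfc_le (hφ : IsState φ) (hTr : IsTracial φ)
    (hs : ∀ i, IsSelfAdjoint (s i)) {a : A} (ha : IsSelfAdjoint a) {f : ℝ → ℝ} (hf : Continuous f)
    {ε : ℝ} (h : ∀ x ∈ spectrum ℝ a, |f x| ≤ ε) :
    |(φ ((∑ i ∈ Finset.range n, s i ^ 2) * cfc f a)).re| ≤
      ε * (φ (∑ i ∈ Finset.range n, s i ^ 2)).re := by
  have h1 := re_map_sumSq_mul_cfc_nonneg (n := n) hφ hTr hs (a := a) (f := fun x => ε - f x)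
    (by fun_prop) fun x hx => by linarith [(abs_le.mp (h x hx)).2]
  have h2 := re_map_sumSq_mul_cfc_nonneg (n := n) hφ hTr hs (a := a) (f := fun x => ε + f x)
    (by fun_prop) fun x hx => by linarith [(abs_le.mp (h x hx)).1]
  rw [cfc_sub (fun _ => ε) f a, cfc_const ε a, mul_sub, map_sub, Complex.sub_re,
    Algebra.algebraMap_eq_smul_one, mul_smul_comm, mul_one, LinearMap.map_smul_of_tower,
    Complex.real_smul, Complex.re_ofReal_mul] at h1
  rw [cfc_const_add ε f a, mul_add, map_add, Complex.add_re,
    Algebra.algebraMap_eq_smul_one, mul_smul_comm, mul_one, LinearMap.map_smul_of_tower,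
    Complex.real_smul, Complex.re_ofReal_mul] at h2
  rw [abs_le]
  constructor <;> linarith

end CStar

section Spectrum

variable {A : Type*} [CStarAlgebra A] {φ : A →ₗ[ℂ] ℂ} {s : ℕ → A} {n : ℕ}

theorem re_map_sumSq_mul_aeval (h1 : φ 1 = 1)
    (h0 : ∀ k, φ (sumDoubled n (k + 1) (wick s)) = 0) (p : ℝ[X]) :
    (φ ((∑ i ∈ Finset.range n, s i ^ 2) * aeval (∑ i ∈ Finset.range n, s i ^ 2) p)).re =
      n * semi fun t => p.eval (n + 1 + Real.sqrt n * t) := by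
  induction mem_span_shiftCheb n p using Submodule.span_induction with
  | mem p hp =>
    obtain ⟨k, rfl⟩ := hp
    rw [map_mul_aeval_shiftCheb h1 h0, semi_shiftCheb]
    split_ifs <;> simp
  | zero => simp [semi]
  | add p q _ _ hp hq =>
    simp only [map_add, mul_add, Complex.add_re, hp, hq, eval_add]
    rw [semi_add (by fun_prop) (by fun_prop), mul_add]
  | smul a p _ hp =>
    rw [map_smul, mul_smul_comm, LinearMap.map_smul_of_tower, Complex.real_smul,
      Complex.re_ofReal_mul, hp]
    simp only [eval_smul, smul_eq_mul]
    rw [semi_const_mul]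
    ring

theorem re_map_sumSq_mul_cfc [Nontrivial A] (hφ : IsState φ) (hTr : IsTracial φ)
    (hs : ∀ i, IsSelfAdjoint (s i))
    (h0 : ∀ k, φ (sumDoubled n (k + 1) (wick s)) = 0) {f : ℝ → ℝ} (hf : Continuous f) :
    (φ ((∑ i ∈ Finset.range n, s i ^ 2) * cfc f (∑ i ∈ Finset.range n, s i ^ 2))).re =
      n * semi fun t => f (n + 1 + Real.sqrt n * t) := by
  have hpoly := re_map_sumSq_mul_aeval hφ.1 h0
  have hsa := isSelfAdjoint_sumSq (n := n) hs
  have hbound := fun (g : ℝ → ℝ) (hg : Continuous g) (ε : ℝ) =>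
    abs_re_map_sumSq_mul_cfc_le (n := n) hφ hTr hs hsa hg (ε := ε)
  have hφT : (φ (∑ i ∈ Finset.range n, s i ^ 2)).re = n := by
    have := hpoly 1
    simpa [semi_const] using this
  rw [hφT] at hbound
  set T := ∑ i ∈ Finset.range n, s i ^ 2
  set R : ℝ := max ‖T‖ (n + 1 + 2 * Real.sqrt n)
  refine eq_of_abs_sub_le_all fun ε hε => ?_
  obtain ⟨p, hp⟩ := exists_polynomial_near_of_continuousOn (-R) R f hf.continuousOn
    (ε / (2 * (n + 1))) (by positivity)
  have hT := hbound (fun x => f x - p.eval x) (by fun_prop) (ε / (2 * (n + 1))) fun x hx => by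
    rw [abs_sub_comm]
    refine (hp x ?_).le
    exact abs_le.mp ((spectrum.norm_le_norm_of_mem hx).trans (le_max_left _ _))
  rw [cfc_sub f p.eval T, cfc_polynomial p T, mul_sub, map_sub, Complex.sub_re, hpoly] at hT
  have hmem : ∀ t ∈ Set.Icc (-2 : ℝ) 2, n + 1 + Real.sqrt n * t ∈ Set.Icc (-R) R := by
    intro t ht
    have h1 : n + 1 + 2 * Real.sqrt n ≤ R := le_max_right _ _
    have h2 := Real.sqrt_nonneg n
    have h3 : (0 : ℝ) ≤ n := n.cast_nonneg
    constructor <;> nlinarith [ht.1, ht.2]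
  have hS1 := semi_mono (f := fun t => f (n + 1 + Real.sqrt n * t))
    (g := fun t => p.eval (n + 1 + Real.sqrt n * t) + ε / (2 * (n + 1)))
    (by fun_prop) (by fun_prop) fun t ht => by linarith [(abs_lt.mp (hp _ (hmem t ht))).1]
  have hS2 := semi_mono (f := fun t => p.eval (n + 1 + Real.sqrt n * t))
    (g := fun t => f (n + 1 + Real.sqrt n * t) + ε / (2 * (n + 1)))
    (by fun_prop) (by fun_prop) fun t ht => by linarith [(abs_lt.mp (hp _ (hmem t ht))).2]
  rw [semi_add (by fun_prop) (by fun_prop), semi_const] at hS1 hS2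
  have hn : (0 : ℝ) ≤ n := n.cast_nonneg
  have hS1' := mul_le_mul_of_nonneg_left hS1 hn
  have hS2' := mul_le_mul_of_nonneg_left hS2 hn
  have hε' : ε / (2 * (n + 1)) * n ≤ ε / 2 := by
    rw [div_mul_eq_mul_div, div_le_div_iff₀ (by positivity) (by positivity)]
    nlinarith
  rw [abs_le] at hT ⊢
  constructor <;> linarith [hT.1, hT.2]

theorem sumSq_mul_cfc_eq_zero (hφ : IsState φ) (hTr : IsTracial φ) (hFa : IsFaithful φ)
    (hs : ∀ i, IsSelfAdjoint (s i)) {a : A} (ha : IsSelfAdjoint a) {g : ℝ → ℝ} (hg : Continuous g)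
    (h : (φ ((∑ i ∈ Finset.range n, s i ^ 2) * cfc (fun x => g x ^ 2) a)).re = 0) :
    (∑ i ∈ Finset.range n, s i ^ 2) * cfc g a = 0 := by
  have hsa : star (cfc g a) = cfc g a := (cfc_predicate g a : IsSelfAdjoint _).star_eq
  have h2 : ∀ i, s i * cfc (fun x => g x ^ 2) a * s i =
      star (cfc g a * s i) * (cfc g a * s i) := fun i => by
    rw [star_mul, (hs i).star_eq, hsa, cfc_pow g 2 a]
    noncomm_ring
  rw [map_sumSq_mul_eq_sum hTr, Complex.re_sum,
    Finset.sum_eq_zero_iff_of_nonneg fun i _ => by rw [h2]; exact (hφ.2 _).1] at h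
  have h3 : cfc g a * ∑ i ∈ Finset.range n, s i ^ 2 = 0 := by
    rw [Finset.mul_sum]
    refine Finset.sum_eq_zero fun i hi => ?_
    have := h i hi
    rw [h2] at this
    rw [sq, ← mul_assoc, hFa _ (Complex.ext this (hφ.2 _).2), zero_mul]
  rw [← star_eq_zero, star_mul, hsa, (isSelfAdjoint_sumSq hs).star_eq, h3]

theorem spectrum_sumSq_subset [Nontrivial A] (hφ : IsState φ) (hTr : IsTracial φ)
    (hFa : IsFaithful φ) (hs : ∀ i, IsSelfAdjoint (s i))
    (h0 : ∀ k, φ (sumDoubled n (k + 1) (wick s)) = 0) {x : ℝ}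
    (hx : x ∈ spectrum ℝ (∑ i ∈ Finset.range n, s i ^ 2)) (hx0 : x ≠ 0) :
    |x - (n + 1)| ≤ 2 * Real.sqrt n := by
  set g : ℝ → ℝ := fun y => max 0 (|y - (n + 1)| - 2 * Real.sqrt n) with hg
  have hgc : Continuous g := by fun_prop
  have hsa := isSelfAdjoint_sumSq (n := n) hs
  have key := re_map_sumSq_mul_cfc hφ hTr hs h0 (f := fun x => g x ^ 2) (by fun_prop)
  have hz : semi (fun t => g (n + 1 + Real.sqrt n * t) ^ 2) = 0 := by
    unfold semi
    have : ∀ θ, g (n + 1 + Real.sqrt n * (2 * Real.cos θ)) = 0 := by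
      intro θ
      have h1 := Real.abs_cos_le_one θ
      have h2 := Real.sqrt_nonneg n
      simp only [hg, add_sub_cancel_left, max_eq_left_iff, abs_mul, abs_of_nonneg h2, abs_two]
      nlinarith
    simp [this]
  rw [hz, mul_zero] at key
  have h3 := sumSq_mul_cfc_eq_zero hφ hTr hFa hs hsa hgc key
  set T := ∑ i ∈ Finset.range n, s i ^ 2
  have h4 : cfc (fun y => y * g y) T = cfc (fun _ : ℝ => (0 : ℝ)) T := by
    rw [cfc_mul (fun y => y) g T, cfc_id' ℝ T, h3, cfc_const_zero]
  have h5 : (spectrum ℝ T).EqOn (fun y => y * g y) fun _ => 0 := eqOn_of_cfc_eq_cfc h4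
  have h6 : g x = 0 := by simpa [hx0] using h5 hx
  simpa [hg] using h6

theorem mem_spectrum_sumSq [Nontrivial A] (hφ : IsState φ) (hTr : IsTracial φ)
    (hs : ∀ i, IsSelfAdjoint (s i)) (hn : 0 < n)
    (h0 : ∀ k, φ (sumDoubled n (k + 1) (wick s)) = 0) {x : ℝ}
    (hx : |x - (n + 1)| ≤ 2 * Real.sqrt n) :
    x ∈ spectrum ℝ (∑ i ∈ Finset.range n, s i ^ 2) := by
  have hsa := isSelfAdjoint_sumSq (n := n) hs
  set g : ℝ → ℝ := fun y => Metric.infDist y (spectrum ℝ (∑ i ∈ Finset.range n, s i ^ 2)) with hg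
  have hgc : Continuous g := Metric.continuous_infDist_pt _
  have key := re_map_sumSq_mul_cfc hφ hTr hs h0 (f := fun x => g x ^ 2) (by fun_prop)
  set T := ∑ i ∈ Finset.range n, s i ^ 2
  have hne : (spectrum ℝ T).Nonempty := ContinuousFunctionalCalculus.spectrum_nonempty T hsa
  have hcl : IsClosed (spectrum ℝ T) := spectrum.isClosed T
  have h1 : cfc (fun x => g x ^ 2) T = 0 := by
    rw [← cfc_const_zero ℝ T]
    exact cfc_congr fun y hy => by simp [hg, Metric.infDist_zero_of_mem hy]
  have hr : 0 < Real.sqrt n := Real.sqrt_pos.mpr (by exact_mod_cast hn)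
  have hnR : (n : ℝ) ≠ 0 := by positivity
  rw [h1, mul_zero, map_zero, Complex.zero_re, semi, eq_comm] at key
  have h2 : ∫ θ in (0 : ℝ)..Real.pi,
      g (n + 1 + Real.sqrt n * (2 * Real.cos θ)) ^ 2 * Real.sin θ ^ 2 = 0 := by
    simpa [hnR, Real.pi_ne_zero] using key
  have h3 : ∀ θ ∈ Set.Ioo 0 Real.pi, g (n + 1 + Real.sqrt n * (2 * Real.cos θ)) = 0 := by
    intro θ hθ
    by_contra hne0
    have hs0 := Real.sin_pos_of_mem_Ioo hθ
    refine (intervalIntegral.integral_pos Real.pi_pos (Continuous.continuousOn (by fun_prop))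
      (fun _ _ => by positivity) ⟨θ, ⟨hθ.1.le, hθ.2.le⟩, ?_⟩).ne' h2
    positivity
  have h4 : ∀ θ ∈ Set.Icc 0 Real.pi, g (n + 1 + Real.sqrt n * (2 * Real.cos θ)) = 0 := by
    have hclosed : IsClosed {θ : ℝ | g (n + 1 + Real.sqrt n * (2 * Real.cos θ)) = 0} :=
      isClosed_eq (by fun_prop) continuous_const
    rw [← closure_Ioo Real.pi_pos.ne]
    exact hclosed.closure_subset_iff.mpr h3
  have h5 := h4 (Real.arccos ((x - (n + 1)) / (2 * Real.sqrt n)))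
    ⟨Real.arccos_nonneg _, Real.arccos_le_pi _⟩
  obtain ⟨hx1, hx2⟩ := abs_le.mp hx
  rw [Real.cos_arccos (by rw [le_div_iff₀ (by positivity)]; linarith)
    (by rw [div_le_iff₀ (by positivity)]; linarith),
    show (n : ℝ) + 1 + Real.sqrt n * (2 * ((x - (n + 1)) / (2 * Real.sqrt n))) = x by
      field_simp; ring] at h5
  exact (hcl.mem_iff_infDist_zero hne).mpr h5

theorem zero_notMem_spectrum_sumSq [Nontrivial A] (hφ : IsState φ) (hTr : IsTracial φ)
    (hFa : IsFaithful φ) (hs : ∀ i, IsSelfAdjoint (s i)) (hn : 1 < n)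
    (h0 : ∀ k, φ (sumDoubled n (k + 1) (wick s)) = 0) :
    (0 : ℝ) ∉ spectrum ℝ (∑ i ∈ Finset.range n, s i ^ 2) := by
  intro hmem
  have hnR : (1 : ℝ) < n := by exact_mod_cast hn
  have hr : 1 < Real.sqrt n := by rwa [Real.lt_sqrt zero_le_one, one_pow]
  have hr2 : Real.sqrt n ^ 2 = n := Real.sq_sqrt (by linarith)
  set α : ℝ := n + 1 - 2 * Real.sqrt n with hα
  have hα0 : 0 < α := by nlinarith
  set h : ℝ → ℝ := fun y => (max y α)⁻¹ with hh
  have hmax : ∀ y, max y α ≠ 0 := fun y => (hα0.trans_le (le_max_right _ _)).ne'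
  have hhc : Continuous h := by fun_prop (disch := exact hmax _)
  have hsa := isSelfAdjoint_sumSq (n := n) hs
  have hsub := fun x => spectrum_sumSq_subset hφ hTr hFa hs h0 (x := x)
  have key := re_map_sumSq_mul_cfc hφ hTr hs h0 hhc
  set T := ∑ i ∈ Finset.range n, s i ^ 2
  have hsemi : n * semi (fun t => h (n + 1 + Real.sqrt n * t)) = 1 := by
    have hint := integral_sin_sq_div (r := (Real.sqrt n)⁻¹) (by positivity)
      (inv_lt_one_of_one_lt₀ hr)
    have : ∀ θ : ℝ, h (n + 1 + Real.sqrt n * (2 * Real.cos θ)) * Real.sin θ ^ 2 =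
        (n : ℝ)⁻¹ * (Real.sin θ ^ 2 / (1 + 2 * (Real.sqrt n)⁻¹ * Real.cos θ +
          (Real.sqrt n)⁻¹ ^ 2)) := by
      intro θ
      have h1 : α ≤ n + 1 + Real.sqrt n * (2 * Real.cos θ) := by
        nlinarith [Real.neg_one_le_cos θ]
      have h2 : (n : ℝ) * (1 + 2 * (Real.sqrt n)⁻¹ * Real.cos θ + (Real.sqrt n)⁻¹ ^ 2) =
          n + 1 + Real.sqrt n * (2 * Real.cos θ) := by
        have e1 : (n : ℝ) * (Real.sqrt n)⁻¹ = Real.sqrt n := by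
          rw [← div_eq_mul_inv, div_eq_iff (by positivity), ← sq, hr2]
        have e2 : (n : ℝ) * (Real.sqrt n)⁻¹ ^ 2 = 1 := by
          rw [inv_pow, hr2, mul_inv_cancel₀ (by positivity)]
        linear_combination 2 * Real.cos θ * e1 + e2
      simp only [hh]
      rw [max_eq_left h1, ← h2, mul_inv]
      ring
    simp only [semi, this]
    rw [intervalIntegral.integral_const_mul, hint]
    have := Real.pi_pos
    field_simp
  rw [hsemi] at key
  set k : ℝ → ℝ := fun y => 1 - y * h y with hk
  have hkc : ContinuousOn k (spectrum ℝ T) :=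
    (continuous_const.sub (continuous_id.mul hhc)).continuousOn
  have hkT : cfc k T = 1 - T * cfc h T := by
    rw [hk, cfc_sub (fun _ => (1 : ℝ)) (fun y => y * h y) T continuousOn_const
      (continuous_id.mul hhc).continuousOn, cfc_const_one ℝ T,
      cfc_mul (fun y => y) h T continuousOn_id hhc.continuousOn, cfc_id' ℝ T]
  have hkk : cfc k T = cfc k T * cfc k T := by
    rw [← cfc_mul k k T hkc hkc]
    refine cfc_congr fun y hy => ?_
    by_cases hy0 : y = 0
    · simp [hk, hy0]
    · have h1 := (abs_le.mp (hsub y hy hy0)).1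
      have h2 : α ≤ y := by linarith
      have h3 : k y = 0 := by
        simp only [hk, hh]
        rw [max_eq_left h2, mul_inv_cancel₀ hy0, sub_self]
      simp [h3]
  have hkre : (φ (cfc k T)).re = 0 := by
    rw [hkT, map_sub, hφ.1, Complex.sub_re, key, Complex.one_re, sub_self]
  have hkstar : cfc k T = star (cfc k T) * cfc k T := by
    rw [(cfc_predicate k T : IsSelfAdjoint _).star_eq]
    exact hkk
  have hk0 : cfc k T = cfc (fun _ : ℝ => (0 : ℝ)) T := by
    rw [cfc_const_zero]
    refine hFa _ (Complex.ext ?_ (hφ.2 _).2)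
    rw [← hkstar, hkre, Complex.zero_re]
  have := eqOn_of_cfc_eq_cfc hk0 hkc continuousOn_const hsa hmem
  simp [hk] at this

theorem spectrum_sumSq (hφ : IsState φ) (hTr : IsTracial φ) (hFa : IsFaithful φ)
    (hn : 0 < n) (hfree : AreFree φ s) (hsc : ∀ i, IsStdSemicircular φ (s i)) :
    spectrum ℝ (∑ i ∈ Finset.range n, s i ^ 2) = {x : ℝ | |x - (n + 1)| ≤ 2 * Real.sqrt n} := by
  have : Nontrivial A := ⟨1, 0, fun h => by simpa [h] using hφ.1⟩
  have hs : ∀ i, IsSelfAdjoint (s i) := fun i => (hsc i).1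
  have h0 : ∀ k, φ (sumDoubled n (k + 1) (wick s)) = 0 := fun k => by
    rw [sumDoubled, map_sum]
    exact Finset.sum_eq_zero fun i _ => map_sumDoubled_eq_zero φ n k _ fun w =>
      map_wick_eq_zero hfree (fun i k => map_aeval_chebyshev (hsc i) k) _ (by simp)
  ext x
  refine ⟨fun hx => ?_, fun hx => mem_spectrum_sumSq hφ hTr hs hn h0 hx⟩
  by_cases hx0 : x = 0
  · rcases Nat.lt_or_ge 1 n with h1 | h1
    · exact absurd (hx0 ▸ hx) (zero_notMem_spectrum_sumSq hφ hTr hFa hs h1 h0)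
    · obtain rfl : n = 1 := le_antisymm h1 hn
      norm_num [hx0]
  · exact spectrum_sumSq_subset hφ hTr hFa hs h0 hx hx0

theorem norm_and_spectrum (hφ : IsState φ) (hTr : IsTracial φ) (hFa : IsFaithful φ)
    (hn : 0 < n) (hfree : AreFree φ s) (hsc : ∀ i, IsStdSemicircular φ (s i)) :
    ‖((n : ℂ))⁻¹ • (∑ i ∈ Finset.range n, s i ^ 2) - (1 : A)‖ =
      2 / Real.sqrt n + 1 / n ∧
    spectrum ℂ (((n : ℂ))⁻¹ • (∑ i ∈ Finset.range n, s i ^ 2)) =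
      (fun r : ℝ => (r : ℂ)) ''
        Set.Icc (1 - 2 / Real.sqrt n + 1 / n) (1 + 2 / Real.sqrt n + 1 / n) := by
  have : Nontrivial A := ⟨1, 0, fun h => by simpa [h] using hφ.1⟩
  have hsa := isSelfAdjoint_sumSq (n := n) fun i => (hsc i).1
  have hspec := spectrum_sumSq hφ hTr hFa hn hfree hsc
  set T := ∑ i ∈ Finset.range n, s i ^ 2
  have hnR : (0 : ℝ) < n := by exact_mod_cast hn
  have hr : 0 < Real.sqrt n := Real.sqrt_pos.mpr hnR
  have hr2 : Real.sqrt n ^ 2 = n := Real.sq_sqrt hnR.le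
  have hcT : ((n : ℂ))⁻¹ • T = cfc (fun x : ℝ => (n : ℝ)⁻¹ * x) T := by
    rw [cfc_const_mul_id (n : ℝ)⁻¹ T, ← Complex.coe_smul]
    push_cast
    rfl
  have h2 : 2 / Real.sqrt n * n = 2 * Real.sqrt n := by
    nth_rw 2 [← hr2]
    field_simp
  have hmem : ∀ x : ℝ, |x - (n + 1)| ≤ 2 * Real.sqrt n ↔ (n : ℝ)⁻¹ * x ∈
      Set.Icc (1 - 2 / Real.sqrt n + 1 / n) (1 + 2 / Real.sqrt n + 1 / n) := by
    intro x
    obtain ⟨y, rfl⟩ : ∃ y, x = y * n := ⟨x / n, by field_simp⟩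
    have e : (n : ℝ)⁻¹ * (y * n) = y := by field_simp
    have e2 : (1 : ℝ) / n * n = 1 := by field_simp
    rw [e, abs_le, Set.mem_Icc,
      ← mul_le_mul_iff_left₀ hnR (b := 1 - 2 / Real.sqrt n + 1 / n),
      ← mul_le_mul_iff_left₀ hnR (b := y), add_mul, sub_mul, add_mul, add_mul, h2, e2]
    constructor <;> rintro ⟨h1, h2⟩ <;> constructor <;> linarith
  have hspecR : spectrum ℝ (((n : ℂ))⁻¹ • T) =
      Set.Icc (1 - 2 / Real.sqrt n + 1 / n) (1 + 2 / Real.sqrt n + 1 / n) := by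
    rw [hcT, cfc_map_spectrum (fun x : ℝ => (n : ℝ)⁻¹ * x) T, hspec]
    ext y
    constructor
    · rintro ⟨x, hx, rfl⟩
      exact (hmem x).mp hx
    · intro hy
      have e : (n : ℝ)⁻¹ * (n * y) = y := by field_simp
      exact ⟨n * y, (hmem _).mpr (by rwa [e]), e⟩
  have hsa' : IsSelfAdjoint (((n : ℂ))⁻¹ • T) := by
    rw [hcT]
    exact cfc_predicate _ _
  constructor
  · have hsub : ((n : ℂ))⁻¹ • T - 1 = cfc (fun x : ℝ => x - 1) (((n : ℂ))⁻¹ • T) := by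
      rw [cfc_sub (fun x : ℝ => x) (fun _ => 1) _, cfc_id' ℝ _, cfc_const_one ℝ _]
    rw [hsub]
    have hgr := IsGreatest.norm_cfc (fun x : ℝ => x - 1) (((n : ℂ))⁻¹ • T)
    rw [hspecR] at hgr
    refine hgr.unique ⟨⟨1 + 2 / Real.sqrt n + 1 / n, ⟨?_, le_rfl⟩, ?_⟩, ?_⟩
    · have : 0 ≤ 2 / Real.sqrt n := by positivity
      linarith
    · simp only
      rw [Real.norm_of_nonneg] <;> ring_nf
      positivity
    · rintro _ ⟨x, hx, rfl⟩
      have : (0 : ℝ) < 1 / n := by positivity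
      simp only [Real.norm_eq_abs, abs_le]
      constructor <;> linarith [hx.1, hx.2]
  · rw [← hspecR]
    exact hsa'.spectrumRestricts.algebraMap_image.symm

end Spectrum

end FreeSemicircular

/-- Equation (4.2): for free standard semicircular elements `s 0, …, s (n-1)`,
`‖(1/n)·∑ s_i² - 1‖ = 2/√n + 1/n`, and the spectrum of `(1/n)·∑ s_i²` is the interval
`[1 - 2/√n + 1/n, 1 + 2/√n + 1/n]`. -/
theorem stmt_14 (A : Type*) [NormedRing A] [StarRing A] [CStarRing A] [NormedAlgebra ℂ A]
    [CompleteSpace A] [StarModule ℂ A]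
    (φ : A →ₗ[ℂ] ℂ) (hφ : IsState φ) (hTr : IsTracial φ) (hFa : IsFaithful φ)
    (n : ℕ) (hn : 0 < n) (s : ℕ → A)
    (hfree : AreFree φ s)
    (hsc : ∀ i, IsStdSemicircular φ (s i)) :
    ‖((n : ℂ))⁻¹ • (∑ i ∈ Finset.range n, s i ^ 2) - (1 : A)‖ =
      2 / Real.sqrt n + 1 / n ∧
    spectrum ℂ (((n : ℂ))⁻¹ • (∑ i ∈ Finset.range n, s i ^ 2)) =
      (fun r : ℝ => (r : ℂ)) ''
        Set.Icc (1 - 2 / Real.sqrt n + 1 / n) (1 + 2 / Real.sqrt n + 1 / n) := by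
  let _ : CStarAlgebra A := { }
  exact FreeSemicircular.norm_and_spectrum hφ hTr hFa hn hfree hsc
end
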